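/- arXiv:2411.08809 — 12 statements merged into one kernel-verified Lean document; each statement's English description precedes it below -/
import Mathlib

section
/- The map Θ_φ(φ,t) = (arctan(t·cos φ), arctan(t·sin φ)) is a bijection from the set (0, π/2) × (0, ∞) onto the set (0, π/2) × (0, π/2). -/
/-- The map `Θ_φ(φ,t) = (arctan (t cos φ), arctan (t sin φ))` is a bijection from
`(0, π/2) × (0, ∞)` onto `(0, π/2) × (0, π/2)`. -/
theorem stmt_0 :
    Set.BijOn
      (fun p : ℝ × ℝ => (Real.arctan (p.2 * Real.cos p.1), Real.arctan (p.2 * Real.sin p.1)))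
      (Set.Ioo 0 (Real.pi / 2) ×ˢ Set.Ioi 0)
      (Set.Ioo 0 (Real.pi / 2) ×ˢ Set.Ioo 0 (Real.pi / 2)) := by
  refine ⟨?_, ?_, ?_⟩
  · rintro ⟨φ, t⟩ ⟨⟨hφ₀, hφ₁⟩, ht⟩
    simp only [Set.mem_Ioi] at hφ₀ hφ₁ ht
    have hc : 0 < Real.cos φ := Real.cos_pos_of_mem_Ioo ⟨by linarith, hφ₁⟩
    have hs : 0 < Real.sin φ := Real.sin_pos_of_pos_of_lt_pi hφ₀ (by linarith)
    exact ⟨⟨Real.arctan_pos.2 (mul_pos ht hc), Real.arctan_lt_pi_div_two _⟩,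
      ⟨Real.arctan_pos.2 (mul_pos ht hs), Real.arctan_lt_pi_div_two _⟩⟩
  · rintro ⟨φ, t⟩ ⟨⟨hφ₀, hφ₁⟩, ht⟩ ⟨ψ, s⟩ ⟨⟨hψ₀, hψ₁⟩, hs⟩ h
    simp only [Set.mem_Ioi, Prod.mk.injEq, Real.arctan_inj] at hφ₀ hφ₁ ht hψ₀ hψ₁ hs h
    obtain ⟨hcos, hsin⟩ := h
    have hsq : t ^ 2 = s ^ 2 := by
      linear_combination (t * Real.cos φ + s * Real.cos ψ) * hcos
        + (t * Real.sin φ + s * Real.sin ψ) * hsin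
        - t ^ 2 * Real.sin_sq_add_cos_sq φ + s ^ 2 * Real.sin_sq_add_cos_sq ψ
    obtain rfl : t = s := (sq_eq_sq₀ ht.le hs.le).1 hsq
    have hφψ : φ = ψ := Real.injOn_cos ⟨hφ₀.le, by linarith⟩ ⟨hψ₀.le, by linarith⟩
      (mul_left_cancel₀ ht.ne' hcos)
    rw [hφψ]
  · rintro ⟨a, b⟩ ⟨⟨ha₀, ha₁⟩, hb₀, hb₁⟩
    simp only at ha₀ ha₁ hb₀ hb₁
    have hx : 0 < Real.tan a := Real.tan_pos_of_pos_of_lt_pi_div_two ha₀ ha₁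
    have hy : 0 < Real.tan b := Real.tan_pos_of_pos_of_lt_pi_div_two hb₀ hb₁
    set φ := Real.arctan (Real.tan b / Real.tan a) with hφ
    have hc : 0 < Real.cos φ := Real.cos_arctan_pos _
    have hcos : Real.tan a / Real.cos φ * Real.cos φ = Real.tan a :=
      div_mul_cancel₀ _ hc.ne'
    have hsin : Real.tan a / Real.cos φ * Real.sin φ = Real.tan b := by
      rw [div_mul_eq_mul_div, mul_div_assoc, ← Real.tan_eq_sin_div_cos, hφ, Real.tan_arctan,
        mul_div_cancel₀ _ hx.ne']
    refine ⟨(φ, Real.tan a / Real.cos φ),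
      ⟨⟨Real.arctan_pos.2 (div_pos hy hx), Real.arctan_lt_pi_div_two _⟩, div_pos hx hc⟩, ?_⟩
    simp only [hcos, hsin]
    rw [Real.arctan_tan (by linarith) ha₁, Real.arctan_tan (by linarith) hb₁]
end

section
/- The map Θ_ψ(ψ,t) = (arctan(t·cos ψ), arccot(t·sin ψ)) is a bijection from the set (0, π/2) × (0, ∞) onto the set (0, π/2) × (0, π/2), where arccot x ∈ (0, π/2) denotes the inverse cotangent of a positive real x (i.e., arccot x = arctan(1/x) for x > 0). -/
/-- Polar coordinates are a bijection from `(0, π/2) × (0, ∞)` onto the open first quadrant. -/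
theorem bijOn_polar_firstQuadrant :
    Set.BijOn (fun p : ℝ × ℝ => (p.2 * Real.cos p.1, p.2 * Real.sin p.1))
      (Set.Ioo 0 (Real.pi / 2) ×ˢ Set.Ioi 0) (Set.Ioi 0 ×ˢ Set.Ioi 0) := by
  refine ⟨?_, ?_, ?_⟩
  · rintro ⟨ψ, t⟩ ⟨⟨h0, h1⟩, ht⟩
    exact ⟨mul_pos ht (Real.cos_pos_of_mem_Ioo ⟨by linarith, h1⟩),
      mul_pos ht (Real.sin_pos_of_pos_of_lt_pi h0 (by linarith))⟩
  · rintro ⟨ψ, t⟩ ⟨⟨h0, h1⟩, ht⟩ ⟨φ, s⟩ ⟨⟨k0, k1⟩, hs⟩ h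
    simp only [Set.mem_Ioi] at h0 h1 k0 k1 ht hs
    obtain ⟨hc, hn⟩ := Prod.mk.inj h
    dsimp only at hc hn
    have hsq : t ^ 2 = s ^ 2 := by
      calc t ^ 2 = (t * Real.cos ψ) ^ 2 + (t * Real.sin ψ) ^ 2 := by
            linear_combination -t ^ 2 * Real.sin_sq_add_cos_sq ψ
        _ = s ^ 2 := by
            rw [hc, hn]
            linear_combination s ^ 2 * Real.sin_sq_add_cos_sq φ
    obtain rfl : t = s := (sq_eq_sq₀ ht.le hs.le).1 hsq
    rw [Real.injOn_cos ⟨h0.le, by linarith⟩ ⟨k0.le, by linarith⟩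
      (mul_left_cancel₀ ht.ne' hc)]
  · rintro ⟨a, b⟩ ⟨ha, hb⟩
    simp only [Set.mem_Ioi] at ha hb
    have hc := Real.cos_arctan_pos (b / a)
    refine ⟨(Real.arctan (b / a), a / Real.cos (Real.arctan (b / a))),
      ⟨⟨Real.arctan_pos.2 (div_pos hb ha), Real.arctan_lt_pi_div_two _⟩, div_pos ha hc⟩, ?_⟩
    refine Prod.ext (div_mul_cancel₀ a hc.ne') ?_
    calc a / Real.cos (Real.arctan (b / a)) * Real.sin (Real.arctan (b / a))
        = a * Real.tan (Real.arctan (b / a)) := by rw [Real.tan_eq_sin_div_cos]; ring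
      _ = b := by rw [Real.tan_arctan, mul_div_cancel₀ b ha.ne']

/-- The inverse tangent is a bijection from the positive reals onto `(0, π/2)`. -/
theorem bijOn_arctan_Ioi : Set.BijOn Real.arctan (Set.Ioi 0) (Set.Ioo 0 (Real.pi / 2)) :=
  ⟨fun x hx => ⟨Real.arctan_pos.2 hx, Real.arctan_lt_pi_div_two x⟩,
    Real.arctan_injective.injOn,
    fun y hy => ⟨Real.tan y, Real.tan_pos_of_pos_of_lt_pi_div_two hy.1 hy.2,
      Real.arctan_tan (by linarith [hy.1, Real.pi_pos]) hy.2⟩⟩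

/-- Inversion is a bijection of the positive reals. -/
theorem bijOn_one_div_Ioi : Set.BijOn (fun x : ℝ => 1 / x) (Set.Ioi 0) (Set.Ioi 0) :=
  ⟨fun _ hx => Set.mem_Ioi.2 (one_div_pos.2 hx), fun _ _ _ _ h => by simpa using h,
    fun y hy => ⟨1 / y, Set.mem_Ioi.2 (one_div_pos.2 hy), one_div_one_div y⟩⟩

/-- The map `Θ_ψ(ψ,t) = (arctan (t cos ψ), arccot (t sin ψ))` is a bijection from
`(0, π/2) × (0, ∞)` onto `(0, π/2) × (0, π/2)`, where `arccot x = arctan (1/x)` for `x > 0`. -/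
theorem stmt_1 :
    Set.BijOn
      (fun p : ℝ × ℝ =>
        (Real.arctan (p.2 * Real.cos p.1), Real.arctan (1 / (p.2 * Real.sin p.1))))
      (Set.Ioo 0 (Real.pi / 2) ×ˢ Set.Ioi 0)
      (Set.Ioo 0 (Real.pi / 2) ×ˢ Set.Ioo 0 (Real.pi / 2)) :=
  (bijOn_arctan_Ioi.prodMap (bijOn_arctan_Ioi.comp bijOn_one_div_Ioi)).comp
    bijOn_polar_firstQuadrant
end

section
/- Let A, B, H ∈ ℝ^{d×d} be invertible matrices such that A + B·H and A·H⁻¹·B⁻¹ + I are also invertible, and let a, b ∈ ℝ^d. Define the row vector uᵀ = −(aᵀ + bᵀH)(A + BH)⁻¹ and the row vectors u_aᵀ = −aᵀA⁻¹ and u_bᵀ = −bᵀB⁻¹. Then uᵀ = u_aᵀ + (u_bᵀ − u_aᵀ)(A·H⁻¹·B⁻¹ + I)⁻¹. -/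
open Matrix

/-- Lemma behind expansions E1 & E2: if `A, B, H` are invertible with `A + BH` and
`A H⁻¹ B⁻¹ + I` invertible, and `uᵀ = -(aᵀ + bᵀ H)(A + BH)⁻¹`, `u_aᵀ = -aᵀ A⁻¹`,
`u_bᵀ = -bᵀ B⁻¹`, then `uᵀ = u_aᵀ + (u_bᵀ - u_aᵀ)(A H⁻¹ B⁻¹ + I)⁻¹`. -/
theorem stmt_2 {d : ℕ} (A B H : Matrix (Fin d) (Fin d) ℝ) (a b : Fin d → ℝ)
    (hA : IsUnit A) (hB : IsUnit B) (hH : IsUnit H)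
    (hABH : IsUnit (A + B * H)) (hR : IsUnit (A * H⁻¹ * B⁻¹ + 1)) :
    -((a + b ᵥ* H) ᵥ* (A + B * H)⁻¹) =
      -(a ᵥ* A⁻¹) + (-(b ᵥ* B⁻¹) - -(a ᵥ* A⁻¹)) ᵥ* (A * H⁻¹ * B⁻¹ + 1)⁻¹ := by
  rw [isUnit_iff_isUnit_det] at hA hB hH hR
  have hfactor : A + B * H = (A * H⁻¹ * B⁻¹ + 1) * (B * H) := by
    rw [add_mul, one_mul, ← mul_assoc, nonsing_inv_mul_cancel_right B _ hB,
      nonsing_inv_mul_cancel_right H _ hH]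
  have hinv : (A + B * H)⁻¹ = H⁻¹ * B⁻¹ * (A * H⁻¹ * B⁻¹ + 1)⁻¹ := by
    rw [hfactor, Matrix.mul_inv_rev, Matrix.mul_inv_rev]
  have hA_inv : A⁻¹ = H⁻¹ * B⁻¹ * (A * H⁻¹ * B⁻¹ + 1)⁻¹ + A⁻¹ * (A * H⁻¹ * B⁻¹ + 1)⁻¹ := by
    have h : H⁻¹ * B⁻¹ + A⁻¹ = A⁻¹ * (A * H⁻¹ * B⁻¹ + 1) := by
      rw [mul_add, mul_one, mul_assoc A, nonsing_inv_mul_cancel_left A _ hA]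
    rw [← add_mul, h, mul_nonsing_inv_cancel_right _ _ hR]
  have ha : a ᵥ* A⁻¹ = a ᵥ* (H⁻¹ * B⁻¹ * (A * H⁻¹ * B⁻¹ + 1)⁻¹) +
      a ᵥ* (A⁻¹ * (A * H⁻¹ * B⁻¹ + 1)⁻¹) := by
    rw [← vecMul_add, ← hA_inv]
  have hb : (b ᵥ* H) ᵥ* (H⁻¹ * B⁻¹ * (A * H⁻¹ * B⁻¹ + 1)⁻¹) =
      b ᵥ* (B⁻¹ * (A * H⁻¹ * B⁻¹ + 1)⁻¹) := by
    rw [vecMul_vecMul, mul_assoc H⁻¹, mul_nonsing_inv_cancel_left H _ hH]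
  rw [hinv, add_vecMul, hb, sub_vecMul, neg_vecMul, neg_vecMul, vecMul_vecMul, vecMul_vecMul, ha]
  abel
end

section
/- (Nash expansion E1) Fix φ ∈ (0, π/2) and t > 0, and set θ1 = arctan(t·cos φ), θ2 = arctan(t·sin φ). Assume 𝐌, 𝐍, 𝐌_θ, and (1/t)·𝐌·H_φ⁻¹·𝐍⁻¹ + I are invertible. Then the SVO-Nash equilibrium satisfies u_θ = u_N + ((1/t)·𝐌·H_φ⁻¹·𝐍⁻¹ + I)⁻ᵀ · (u_A − u_N). -/
open Matrix

/-- Changing the unknown by the resolvent-type identity `P * (N * S) = M + N * S`: the solution of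
the system with matrix `(M + N * S) * C` interpolates between those with matrices `M` and `N`. -/
theorem Matrix.neg_inv_transpose_mulVec_eq_of_mul_eq_add {n R : Type*} [Fintype n] [DecidableEq n]
    [CommRing R] {M N S C P : Matrix n n R} (a b : n → R)
    (hM : IsUnit M) (hN : IsUnit N) (hMC : IsUnit ((M + N * S) * C)) (hP : IsUnit P)
    (h : P * (N * S) = M + N * S) :
    -((((M + N * S) * C)⁻¹)ᵀ *ᵥ (Cᵀ *ᵥ (a + Sᵀ *ᵥ b))) =
      -((M⁻¹)ᵀ *ᵥ a) + (P⁻¹)ᵀ *ᵥ (-((N⁻¹)ᵀ *ᵥ b) - -((M⁻¹)ᵀ *ᵥ a)) := by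
  rw [Matrix.isUnit_iff_isUnit_det] at hM hN hMC hP
  have cancel {A : Matrix n n R} (hA : IsUnit A.det) (v : n → R) : Aᵀ *ᵥ ((A⁻¹)ᵀ *ᵥ v) = v := by
    rw [mulVec_mulVec, ← transpose_mul, nonsing_inv_mul _ hA, transpose_one, one_mulVec]
  have cancel' {A : Matrix n n R} (hA : IsUnit A.det) (v : n → R) : (A⁻¹)ᵀ *ᵥ (Aᵀ *ᵥ v) = v := by
    rw [mulVec_mulVec, ← transpose_mul, mul_nonsing_inv _ hA, transpose_one, one_mulVec]
  set x := (M⁻¹)ᵀ *ᵥ a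
  set y := (N⁻¹)ᵀ *ᵥ b
  have hxa : Mᵀ *ᵥ x = a := cancel hM a
  have hyb : Nᵀ *ᵥ y = b := cancel hN b
  set z := (P⁻¹)ᵀ *ᵥ (-y - -x)
  have hzP : Pᵀ *ᵥ z = -y - -x := cancel hP _
  have key : (M + N * S)ᵀ *ᵥ (-x + z) = -(a + Sᵀ *ᵥ b) := by
    rw [mulVec_add]
    nth_rewrite 2 [← h]
    rw [transpose_mul P, ← mulVec_mulVec, hzP, transpose_add, transpose_mul, add_mulVec,
      mulVec_neg, mulVec_neg, mulVec_sub, mulVec_neg, mulVec_neg, hxa, ← mulVec_mulVec y, hyb]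
    abel
  rw [← cancel' hMC (-x + z), transpose_mul, ← mulVec_mulVec (-x + z), key, mulVec_neg, mulVec_neg]

/-- (Nash expansion E1) For `φ ∈ (0, π/2)`, `t > 0`, `θ1 = arctan (t cos φ)`,
`θ2 = arctan (t sin φ)`, if `𝐌`, `𝐍`, `𝐌_θ`, and `(1/t)·𝐌·H_φ⁻¹·𝐍⁻¹ + I` are invertible,
then `u_θ = u_N + ((1/t)·𝐌·H_φ⁻¹·𝐍⁻¹ + I)⁻ᵀ (u_A - u_N)`. -/
theorem stmt_3 {d1 d2 : ℕ} (hd1 : 1 ≤ d1) (hd2 : 1 ≤ d2)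
    (A1 : Matrix (Fin d1) (Fin d1) ℝ) (A2 : Matrix (Fin d2) (Fin d2) ℝ)
    (D1 : Matrix (Fin d2) (Fin d2) ℝ) (D2 : Matrix (Fin d1) (Fin d1) ℝ)
    (B1 : Matrix (Fin d2) (Fin d1) ℝ) (B2 : Matrix (Fin d1) (Fin d2) ℝ)
    (a1 : Fin d1 → ℝ) (a2 : Fin d2 → ℝ) (b1 : Fin d2 → ℝ) (b2 : Fin d1 → ℝ)
    (φ t θ1 θ2 : ℝ) (hφ : φ ∈ Set.Ioo 0 (Real.pi / 2)) (ht : 0 < t)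
    (hθ1 : θ1 = Real.arctan (t * Real.cos φ)) (hθ2 : θ2 = Real.arctan (t * Real.sin φ)) :
    let M : Matrix (Fin d1 ⊕ Fin d2) (Fin d1 ⊕ Fin d2) ℝ := Matrix.fromBlocks A1 B2 B1 A2
    let N : Matrix (Fin d1 ⊕ Fin d2) (Fin d1 ⊕ Fin d2) ℝ := Matrix.fromBlocks D2 B1ᵀ B2ᵀ D1
    let Mθ : Matrix (Fin d1 ⊕ Fin d2) (Fin d1 ⊕ Fin d2) ℝ :=
      Matrix.fromBlocks (Real.cos θ1 • A1 + Real.sin θ1 • D2)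
        (Real.cos θ2 • B2 + Real.sin θ2 • B1ᵀ)
        (Real.cos θ1 • B1 + Real.sin θ1 • B2ᵀ)
        (Real.cos θ2 • A2 + Real.sin θ2 • D1)
    let aθ : Fin d1 ⊕ Fin d2 → ℝ :=
      Sum.elim (Real.cos θ1 • a1 + Real.sin θ1 • b2) (Real.cos θ2 • a2 + Real.sin θ2 • b1)
    let Hφ : Matrix (Fin d1 ⊕ Fin d2) (Fin d1 ⊕ Fin d2) ℝ :=
      Matrix.fromBlocks (Real.cos φ • 1) 0 0 (Real.sin φ • 1)
    let uN : Fin d1 ⊕ Fin d2 → ℝ := -((M⁻¹)ᵀ *ᵥ Sum.elim a1 a2)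
    let uA : Fin d1 ⊕ Fin d2 → ℝ := -((N⁻¹)ᵀ *ᵥ Sum.elim b2 b1)
    let uθ : Fin d1 ⊕ Fin d2 → ℝ := -((Mθ⁻¹)ᵀ *ᵥ aθ)
    IsUnit M → IsUnit N → IsUnit Mθ →
      IsUnit ((1 / t) • (M * Hφ⁻¹ * N⁻¹) + 1) →
      uθ = uN + (((1 / t) • (M * Hφ⁻¹ * N⁻¹) + 1)⁻¹)ᵀ *ᵥ (uA - uN) := by
  intro M N Mθ aθ Hφ uN uA uθ hM hN hMθ hP
  have hc : Real.cos φ ≠ 0 :=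
    (Real.cos_pos_of_mem_Ioo ⟨by linarith [hφ.1, Real.pi_pos], hφ.2⟩).ne'
  have hs : Real.sin φ ≠ 0 :=
    (Real.sin_pos_of_pos_of_lt_pi hφ.1 (by linarith [hφ.2, Real.pi_pos])).ne'
  have hsin (x : ℝ) : Real.sin (Real.arctan x) = Real.cos (Real.arctan x) * x := by
    rw [Real.sin_arctan, Real.cos_arctan]
    ring
  have h1 : Real.sin θ1 = Real.cos θ1 * (t * Real.cos φ) := by rw [hθ1, hsin]
  have h2 : Real.sin θ2 = Real.cos θ2 * (t * Real.sin φ) := by rw [hθ2, hsin]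
  have hH : IsUnit Hφ.det := by
    simp [Hφ, det_fromBlocks_zero₂₁, hc, hs]
  let C : Matrix (Fin d1 ⊕ Fin d2) (Fin d1 ⊕ Fin d2) ℝ :=
    fromBlocks (Real.cos θ1 • 1) 0 0 (Real.cos θ2 • 1)
  have hMθC : Mθ = (M + N * (t • Hφ)) * C := by
    simp [Mθ, M, N, C, Hφ, fromBlocks_multiply, fromBlocks_smul, fromBlocks_add, h1, h2,
      smul_smul, mul_comm, mul_left_comm]
  have haθC : aθ = Cᵀ *ᵥ (Sum.elim a1 a2 + (t • Hφ)ᵀ *ᵥ Sum.elim b2 b1) := by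
    ext i
    cases i <;>
      simp [aθ, C, Hφ, fromBlocks_transpose, fromBlocks_smul, fromBlocks_mulVec, h1, h2,
        smul_mulVec, mulVec_add, smul_smul]
  have h : ((1 / t) • (M * Hφ⁻¹ * N⁻¹) + 1) * (N * (t • Hφ)) = M + N * (t • Hφ) := by
    rw [add_mul, one_mul, smul_mul_assoc, mul_smul_comm, mul_smul_comm, smul_smul,
      one_div_mul_cancel ht.ne', one_smul, ← mul_assoc,
      nonsing_inv_mul_cancel_right _ _ ((isUnit_iff_isUnit_det _).1 hN),
      nonsing_inv_mul_cancel_right _ _ hH]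
  have := neg_inv_transpose_mulVec_eq_of_mul_eq_add (Sum.elim a1 a2) (Sum.elim b2 b1) hM hN
    (hMθC ▸ hMθ) hP h
  rwa [← hMθC, ← haθC] at this
end

section
/- (Player-optimal expansion E2) Fix ψ ∈ (0, π/2) and t > 0, and set θ1 = arctan(t·cos ψ), θ2 = arccot(t·sin ψ) (so cot θ2 = t·sin ψ). Assume M1, M2, 𝐌_θ, and (1/t)·M1·H_ψ⁻¹·M2⁻¹ + I are invertible. Then the SVO-Nash equilibrium satisfies u_θ = u₁ + ((1/t)·M1·H_ψ⁻¹·M2⁻¹ + I)⁻ᵀ · (u₂ − u₁). -/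
open Matrix

/-- The solution of the system with matrix `(M₁ + t M₂ H) C` and right-hand side
`-(c₁ + t c₂ H) C`, expanded around the solution for `M₁`, `c₁`. -/
theorem neg_vecMul_inv_eq_expansion {n : Type*} [Fintype n] [DecidableEq n]
    {M₁ M₂ H C : Matrix n n ℝ} {c₁ c₂ : n → ℝ} {t : ℝ} (ht : t ≠ 0)
    (h₁ : IsUnit M₁) (h₂ : IsUnit M₂) (hH : IsUnit H)
    (hM : IsUnit ((M₁ + t • (M₂ * H)) * C))
    (hK : IsUnit ((1 / t) • (M₁ * H⁻¹ * M₂⁻¹) + 1)) :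
    -((c₁ + t • (c₂ ᵥ* H)) ᵥ* C ᵥ* ((M₁ + t • (M₂ * H)) * C)⁻¹) =
      -(c₁ ᵥ* M₁⁻¹) + (-(c₂ ᵥ* M₂⁻¹) - -(c₁ ᵥ* M₁⁻¹)) ᵥ*
        ((1 / t) • (M₁ * H⁻¹ * M₂⁻¹) + 1)⁻¹ := by
  rw [isUnit_iff_isUnit_det] at h₁ h₂ hH hK
  have hfactor : M₁ + t • (M₂ * H) =
      ((1 / t) • (M₁ * H⁻¹ * M₂⁻¹) + 1) * (t • (M₂ * H)) := by
    rw [add_mul, one_mul, smul_mul_smul_comm, one_div_mul_cancel ht, one_smul,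
      ← Matrix.mul_assoc, nonsing_inv_mul_cancel_right _ _ h₂,
      nonsing_inv_mul_cancel_right _ _ hH]
  apply vecMul_injective_of_isUnit hM
  rw [isUnit_iff_isUnit_det] at hM
  set K := (1 / t) • (M₁ * H⁻¹ * M₂⁻¹) + 1
  have key : (-(c₂ ᵥ* M₂⁻¹) - -(c₁ ᵥ* M₁⁻¹)) ᵥ* K⁻¹ ᵥ* (M₁ + t • (M₂ * H)) =
      (-(c₂ ᵥ* M₂⁻¹) - -(c₁ ᵥ* M₁⁻¹)) ᵥ* (t • (M₂ * H)) := by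
    rw [hfactor, vecMul_vecMul, nonsing_inv_mul_cancel_left _ _ hK]
  have hc₁ : c₁ ᵥ* M₁⁻¹ ᵥ* M₁ = c₁ := by
    rw [vecMul_vecMul, nonsing_inv_mul _ h₁, vecMul_one]
  have hc₂ : c₂ ᵥ* M₂⁻¹ ᵥ* (M₂ * H) = c₂ ᵥ* H := by
    rw [vecMul_vecMul, nonsing_inv_mul_cancel_left _ _ h₂]
  simp only [neg_vecMul]
  rw [vecMul_vecMul _ _ ((M₁ + t • (M₂ * H)) * C), nonsing_inv_mul _ hM, vecMul_one,
    ← vecMul_vecMul, ← neg_vecMul]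
  congr 1
  rw [add_vecMul, key, sub_vecMul, neg_vecMul, neg_vecMul, neg_vecMul, vecMul_add, hc₁]
  simp only [vecMul_smul, hc₂]
  abel

/-- (Player-optimal expansion E2) For `ψ ∈ (0, π/2)`, `t > 0`, `θ1 = arctan (t cos ψ)`,
`θ2 = arccot (t sin ψ) = arctan (1/(t sin ψ))`, if `M1`, `M2`, `𝐌_θ`, and
`(1/t)·M1·H_ψ⁻¹·M2⁻¹ + I` are invertible, then
`u_θ = u₁ + ((1/t)·M1·H_ψ⁻¹·M2⁻¹ + I)⁻ᵀ (u₂ - u₁)`. -/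
theorem stmt_4 {d1 d2 : ℕ} (hd1 : 1 ≤ d1) (hd2 : 1 ≤ d2)
    (A1 : Matrix (Fin d1) (Fin d1) ℝ) (A2 : Matrix (Fin d2) (Fin d2) ℝ)
    (D1 : Matrix (Fin d2) (Fin d2) ℝ) (D2 : Matrix (Fin d1) (Fin d1) ℝ)
    (B1 : Matrix (Fin d2) (Fin d1) ℝ) (B2 : Matrix (Fin d1) (Fin d2) ℝ)
    (a1 : Fin d1 → ℝ) (a2 : Fin d2 → ℝ) (b1 : Fin d2 → ℝ) (b2 : Fin d1 → ℝ)
    (ψ t θ1 θ2 : ℝ) (hψ : ψ ∈ Set.Ioo 0 (Real.pi / 2)) (ht : 0 < t)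
    (hθ1 : θ1 = Real.arctan (t * Real.cos ψ))
    (hθ2 : θ2 = Real.arctan (1 / (t * Real.sin ψ))) :
    let M1 : Matrix (Fin d1 ⊕ Fin d2) (Fin d1 ⊕ Fin d2) ℝ := Matrix.fromBlocks A1 B1ᵀ B1 D1
    let M2 : Matrix (Fin d1 ⊕ Fin d2) (Fin d1 ⊕ Fin d2) ℝ := Matrix.fromBlocks D2 B2 B2ᵀ A2
    let Mθ : Matrix (Fin d1 ⊕ Fin d2) (Fin d1 ⊕ Fin d2) ℝ :=
      Matrix.fromBlocks (Real.cos θ1 • A1 + Real.sin θ1 • D2)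
        (Real.cos θ2 • B2 + Real.sin θ2 • B1ᵀ)
        (Real.cos θ1 • B1 + Real.sin θ1 • B2ᵀ)
        (Real.cos θ2 • A2 + Real.sin θ2 • D1)
    let aθ : Fin d1 ⊕ Fin d2 → ℝ :=
      Sum.elim (Real.cos θ1 • a1 + Real.sin θ1 • b2) (Real.cos θ2 • a2 + Real.sin θ2 • b1)
    let Hψ : Matrix (Fin d1 ⊕ Fin d2) (Fin d1 ⊕ Fin d2) ℝ :=
      Matrix.fromBlocks (Real.cos ψ • 1) 0 0 (Real.sin ψ • 1)
    let u1 : Fin d1 ⊕ Fin d2 → ℝ := -((M1⁻¹)ᵀ *ᵥ Sum.elim a1 b1)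
    let u2 : Fin d1 ⊕ Fin d2 → ℝ := -((M2⁻¹)ᵀ *ᵥ Sum.elim b2 a2)
    let uθ : Fin d1 ⊕ Fin d2 → ℝ := -((Mθ⁻¹)ᵀ *ᵥ aθ)
    IsUnit M1 → IsUnit M2 → IsUnit Mθ →
      IsUnit ((1 / t) • (M1 * Hψ⁻¹ * M2⁻¹) + 1) →
      uθ = u1 + (((1 / t) • (M1 * Hψ⁻¹ * M2⁻¹) + 1)⁻¹)ᵀ *ᵥ (u2 - u1) := by
  intro M1 M2 Mθ aθ Hψ u1 u2 uθ h1 h2 hM hK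
  have hcos : 0 < Real.cos ψ := Real.cos_pos_of_mem_Ioo ⟨by linarith [hψ.1, hψ.2], hψ.2⟩
  have hsin : 0 < Real.sin ψ := Real.sin_pos_of_pos_of_lt_pi hψ.1 (by linarith [hψ.1, hψ.2])
  have hsinθ1 : Real.sin θ1 = t * Real.cos ψ * Real.cos θ1 := by
    rw [hθ1, Real.sin_arctan, Real.cos_arctan]
    ring
  have hcosθ2 : Real.cos θ2 = t * Real.sin ψ * Real.sin θ2 := by
    rw [hθ2, Real.sin_arctan, Real.cos_arctan]
    field_simp
  have hH : IsUnit Hψ := by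
    rw [isUnit_iff_isUnit_det]
    simp [Hψ, det_fromBlocks_zero₂₁, hcos.ne', hsin.ne']
  let C : Matrix (Fin d1 ⊕ Fin d2) (Fin d1 ⊕ Fin d2) ℝ :=
    fromBlocks (Real.cos θ1 • 1) 0 0 (Real.sin θ2 • 1)
  have hMθ : Mθ = (M1 + t • (M2 * Hψ)) * C := by
    simp only [Mθ, M1, M2, Hψ, C, fromBlocks_multiply, fromBlocks_smul, fromBlocks_add, hsinθ1,
      hcosθ2]
    congr 1 <;> ext i j <;> simp <;> ring
  have haθ : aθ = (Sum.elim a1 b1 + t • (Sum.elim b2 a2 ᵥ* Hψ)) ᵥ* C := by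
    ext (i | i) <;>
      simp [aθ, Hψ, C, vecMul_fromBlocks, vecMul_smul, hsinθ1, hcosθ2, Function.comp_def] <;> ring
  simp only [uθ, u1, u2, mulVec_transpose]
  rw [haθ, hMθ]
  exact neg_vecMul_inv_eq_expansion ht.ne' h1 h2 hH (hMθ ▸ hM) hK
end

section
/- (Ellipsoidal bound, E1 version) Assume 𝐌·H_φ⁻¹·𝐍⁻¹ = V·diag(λ_1,…,λ_d)·V⁻¹ with V ∈ ℝ^{d×d} invertible and all λ_i real and strictly positive, and assume u_A ≠ u_N. Set P = V·Vᵀ, r = ‖u_A − u_N‖_P, and for t > 0 let Γ_φ(t) = u_N + ((1/t)·𝐌·H_φ⁻¹·𝐍⁻¹ + I)⁻ᵀ·(u_A − u_N). Then for every t > 0 (the resolvent being invertible since all λ_i > 0), Γ_φ(t) ∈ B_P(u_N, r) ∩ B_P(u_A, r). -/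
open Matrix

lemma dotProduct_mul_transpose_mulVec {n : Type*} [Fintype n] (V : Matrix n n ℝ) (u : n → ℝ) :
    u ⬝ᵥ ((V * Vᵀ) *ᵥ u) = ∑ i, (Vᵀ *ᵥ u) i ^ 2 := by
  rw [← mulVec_mulVec, dotProduct_mulVec, ← mulVec_transpose]
  simp only [dotProduct, sq]

/-- A vector whose coordinates `Vᵀ x` are strict contractions of those of `y ≠ 0` has strictly
smaller norm with respect to `V Vᵀ`. -/
lemma sqrt_quadForm_lt_of_coords {n : Type*} [Fintype n] [DecidableEq n] {V : Matrix n n ℝ}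
    (hV : IsUnit V) {x y : n → ℝ} (hy : y ≠ 0) {c : n → ℝ} (hc : ∀ i, |c i| < 1)
    (hx : Vᵀ *ᵥ x = c * (Vᵀ *ᵥ y)) :
    Real.sqrt (x ⬝ᵥ ((V * Vᵀ) *ᵥ x)) < Real.sqrt (y ⬝ᵥ ((V * Vᵀ) *ᵥ y)) := by
  rw [dotProduct_mul_transpose_mulVec, dotProduct_mul_transpose_mulVec, hx]
  apply Real.sqrt_lt_sqrt (Finset.sum_nonneg fun i _ => sq_nonneg _)
  have hw : Vᵀ *ᵥ y ≠ 0 := fun h =>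
    hy (mulVec_injective_of_isUnit ((isUnit_transpose V).2 hV) (by rw [h, mulVec_zero]))
  obtain ⟨i, hi⟩ := Function.ne_iff.1 hw
  have hc' : ∀ j, c j ^ 2 < 1 := fun j => (sq_lt_one_iff_abs_lt_one _).2 (hc j)
  refine Finset.sum_lt_sum (fun j _ => ?_) ⟨i, Finset.mem_univ i, ?_⟩
  · rw [Pi.mul_apply, mul_pow]
    exact mul_le_of_le_one_left (sq_nonneg _) (hc' j).le
  · rw [Pi.mul_apply, mul_pow]
    exact mul_lt_of_lt_one_left (sq_pos_of_ne_zero hi) (hc' i)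

/-- The transposed resolvent of a diagonalizable matrix is diagonal in the coordinates `Vᵀ u`. -/
lemma transpose_mulVec_resolvent {n : Type*} [Fintype n] [DecidableEq n] {V : Matrix n n ℝ}
    (hV : IsUnit V) {l : n → ℝ} {s : ℝ} (hl : ∀ i, s * l i + 1 ≠ 0) (u : n → ℝ) :
    Vᵀ *ᵥ (((s • (V * diagonal l * V⁻¹) + 1)⁻¹)ᵀ *ᵥ u) =
      (fun i => (s * l i + 1)⁻¹) * (Vᵀ *ᵥ u) := by
  have hdet : IsUnit V.det := (isUnit_iff_isUnit_det V).1 hV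
  have hdiag : s • diagonal l + 1 = diagonal fun i => s * l i + 1 := by
    rw [← diagonal_smul, ← diagonal_one, diagonal_add]
    rfl
  have hK : s • (V * diagonal l * V⁻¹) + 1 = V * (diagonal fun i => s * l i + 1) * V⁻¹ := by
    rw [← hdiag, mul_add, add_mul, mul_one, mul_nonsing_inv V hdet, mul_smul_comm, smul_mul_assoc]
  have hinv : (V * (diagonal fun i => s * l i + 1) * V⁻¹)⁻¹ =
      V * (diagonal fun i => (s * l i + 1)⁻¹) * V⁻¹ := by
    apply inv_eq_right_inv
    calc _ = V * (diagonal fun i => s * l i + 1) * (V⁻¹ * V) *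
          (diagonal fun i => (s * l i + 1)⁻¹) * V⁻¹ := by simp only [mul_assoc]
      _ = 1 := by
        rw [nonsing_inv_mul V hdet, mul_one, mul_assoc V, diagonal_mul_diagonal]
        simp [hl, mul_nonsing_inv V hdet]
  rw [hK, hinv, mulVec_mulVec, ← transpose_mul, mul_assoc, nonsing_inv_mul V hdet, mul_one,
    transpose_mul, diagonal_transpose, ← mulVec_mulVec]
  ext i
  rw [mulVec_diagonal, Pi.mul_apply]

/-- (Ellipsoidal bound, E1 version) If `𝐌 H_φ⁻¹ 𝐍⁻¹ = V diag(λ) V⁻¹` with all `λᵢ > 0`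
and `u_A ≠ u_N`, then for every `t > 0` the point
`Γ_φ(t) = u_N + ((1/t)·𝐌·H_φ⁻¹·𝐍⁻¹ + I)⁻ᵀ (u_A - u_N)` lies in
`B_P(u_N, r) ∩ B_P(u_A, r)` with `P = V Vᵀ` and `r = ‖u_A - u_N‖_P`. -/
theorem stmt_7 {d1 d2 : ℕ} (hd1 : 1 ≤ d1) (hd2 : 1 ≤ d2)
    (A1 : Matrix (Fin d1) (Fin d1) ℝ) (A2 : Matrix (Fin d2) (Fin d2) ℝ)
    (D1 : Matrix (Fin d2) (Fin d2) ℝ) (D2 : Matrix (Fin d1) (Fin d1) ℝ)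
    (B1 : Matrix (Fin d2) (Fin d1) ℝ) (B2 : Matrix (Fin d1) (Fin d2) ℝ)
    (a1 : Fin d1 → ℝ) (a2 : Fin d2 → ℝ) (b1 : Fin d2 → ℝ) (b2 : Fin d1 → ℝ)
    (φ : ℝ) (hφ : φ ∈ Set.Ioo 0 (Real.pi / 2))
    (V : Matrix (Fin d1 ⊕ Fin d2) (Fin d1 ⊕ Fin d2) ℝ) (hV : IsUnit V)
    (lam : Fin d1 ⊕ Fin d2 → ℝ) (hlam : ∀ i, 0 < lam i) :
    let M : Matrix (Fin d1 ⊕ Fin d2) (Fin d1 ⊕ Fin d2) ℝ := Matrix.fromBlocks A1 B2 B1 A2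
    let N : Matrix (Fin d1 ⊕ Fin d2) (Fin d1 ⊕ Fin d2) ℝ := Matrix.fromBlocks D2 B1ᵀ B2ᵀ D1
    let Hφ : Matrix (Fin d1 ⊕ Fin d2) (Fin d1 ⊕ Fin d2) ℝ :=
      Matrix.fromBlocks (Real.cos φ • 1) 0 0 (Real.sin φ • 1)
    let uN : Fin d1 ⊕ Fin d2 → ℝ := -((M⁻¹)ᵀ *ᵥ Sum.elim a1 a2)
    let uA : Fin d1 ⊕ Fin d2 → ℝ := -((N⁻¹)ᵀ *ᵥ Sum.elim b2 b1)
    let P : Matrix (Fin d1 ⊕ Fin d2) (Fin d1 ⊕ Fin d2) ℝ := V * Vᵀ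
    let Pnorm : (Fin d1 ⊕ Fin d2 → ℝ) → ℝ := fun u => Real.sqrt (u ⬝ᵥ (P *ᵥ u))
    let r : ℝ := Pnorm (uA - uN)
    let Γ : ℝ → (Fin d1 ⊕ Fin d2 → ℝ) := fun t =>
      uN + (((1 / t) • (M * Hφ⁻¹ * N⁻¹) + 1)⁻¹)ᵀ *ᵥ (uA - uN)
    IsUnit M → IsUnit N →
      M * Hφ⁻¹ * N⁻¹ = V * Matrix.diagonal lam * V⁻¹ →
      uA ≠ uN →
      ∀ t : ℝ, 0 < t → Pnorm (Γ t - uN) < r ∧ Pnorm (Γ t - uA) < r := by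
  intro M N Hφ uN uA P Pnorm r Γ _ _ hdiag hne t ht
  have hpos : ∀ i, 0 < 1 / t * lam i := fun i => mul_pos (one_div_pos.2 ht) (hlam i)
  have hinv_pos : ∀ i, 0 < (1 / t * lam i + 1)⁻¹ := fun i => inv_pos.2 (by linarith [hpos i])
  have hinv_lt : ∀ i, (1 / t * lam i + 1)⁻¹ < 1 := fun i =>
    inv_lt_one_of_one_lt₀ (by linarith [hpos i])
  have hres := transpose_mulVec_resolvent hV (l := lam) (s := 1 / t)
    (fun i => (add_pos (hpos i) one_pos).ne') (uA - uN)
  have hΓ : Γ t - uN =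
      ((((1 / t) • (V * diagonal lam * V⁻¹) + 1)⁻¹)ᵀ *ᵥ (uA - uN)) := by
    rw [← hdiag]
    exact add_sub_cancel_left _ _
  rw [← hΓ] at hres
  have hy : uA - uN ≠ 0 := sub_ne_zero.2 hne
  refine ⟨sqrt_quadForm_lt_of_coords hV hy (c := fun i => (1 / t * lam i + 1)⁻¹) (fun i => ?_) hres,
    sqrt_quadForm_lt_of_coords hV hy (c := (fun i => (1 / t * lam i + 1)⁻¹) - 1)
      (fun i => ?_) ?_⟩
  · exact abs_lt.2 ⟨by linarith [hinv_pos i], hinv_lt i⟩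
  · exact abs_lt.2 ⟨by simpa using hinv_pos i, by
      simp only [Pi.sub_apply, Pi.one_apply]; linarith [hinv_lt i]⟩
  · rw [← sub_sub_sub_cancel_right (Γ t) uA uN, mulVec_sub, hres, sub_mul, one_mul]
end

section
/- (Joint four-ball bound) Let θ = (θ1, θ2) ∈ (0, π/2) × (0, π/2), and let (φ, t) and (ψ, s) be the unique pairs in (0, π/2) × (0, ∞) with tan θ1 = t·cos φ, tan θ2 = t·sin φ, tan θ1 = s·cos ψ, and cot θ2 = s·sin ψ. Assume 𝐌·H_φ⁻¹·𝐍⁻¹ = V_φ·diag(λ_1,…,λ_d)·V_φ⁻¹ and M1·H_ψ⁻¹·M2⁻¹ = V_ψ·diag(μ_1,…,μ_d)·V_ψ⁻¹ with V_φ, V_ψ invertible real matrices and all λ_i, μ_i real and strictly positive; assume 𝐌, 𝐍, M1, M2, 𝐌_θ are invertible, u_A ≠ u_N, and u₁ ≠ u₂. Set P_φ = V_φ·V_φᵀ, P_ψ = V_ψ·V_ψᵀ, r = ‖u_A − u_N‖_{P_φ}, r' = ‖u₁ − u₂‖_{P_ψ}. Then the SVO-Nash equilibrium satisfies u_θ ∈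 B_{P_φ}(u_N, r) ∩ B_{P_φ}(u_A, r) ∩ B_{P_ψ}(u₁, r') ∩ B_{P_ψ}(u₂, r'). -/
open Matrix

section QuadraticForm

variable {n : Type*} [Fintype n]

theorem dotProduct_mul_transpose_mulVec_self (V : Matrix n n ℝ) (u : n → ℝ) :
    u ⬝ᵥ ((V * Vᵀ) *ᵥ u) = ∑ i, (u ᵥ* V) i ^ 2 := by
  rw [← mulVec_mulVec, dotProduct_mulVec, mulVec_transpose]
  simp [dotProduct, sq]

theorem dotProduct_mulVec_sub_comm (P : Matrix n n ℝ) (u v : n → ℝ) :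
    (u - v) ⬝ᵥ (P *ᵥ (u - v)) = (v - u) ⬝ᵥ (P *ᵥ (v - u)) := by
  rw [← neg_sub v u, mulVec_neg, neg_dotProduct_neg]

variable [DecidableEq n]

theorem sqrt_sum_sq_vecMul_lt {V : Matrix n n ℝ} (hV : IsUnit V) {lam : n → ℝ}
    (hlam : ∀ i, 0 < lam i) {τ : ℝ} (hτ : 0 < τ) {x y : n → ℝ} (hxy : x + y ≠ 0)
    (h : ∀ i, lam i * (x ᵥ* V) i = τ * (y ᵥ* V) i) :
    √(∑ i, (x ᵥ* V) i ^ 2) < √(∑ i, ((x + y) ᵥ* V) i ^ 2) ∧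
      √(∑ i, (y ᵥ* V) i ^ 2) < √(∑ i, ((x + y) ᵥ* V) i ^ 2) := by
  have hx i : (x ᵥ* V) i = τ / lam i * (y ᵥ* V) i := by
    have := (hlam i).ne'
    field_simp
    linarith [h i]
  have hadd i : ((x + y) ᵥ* V) i = (x ᵥ* V) i + (y ᵥ* V) i := by
    rw [add_vecMul, Pi.add_apply]
  have hne : (x + y) ᵥ* V ≠ 0 := fun h0 =>
    hxy (vecMul_injective_of_isUnit hV (by simpa using h0))
  obtain ⟨j, hj⟩ := Function.ne_iff.mp hne
  have hyj : (y ᵥ* V) j ≠ 0 := fun h0 => hj (by simp [hadd, hx, h0])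
  have hpos i : 0 < τ / lam i := div_pos hτ (hlam i)
  constructor <;>
    refine Real.sqrt_lt_sqrt (Finset.sum_nonneg fun i _ => sq_nonneg _)
      (Finset.sum_lt_sum (fun i _ => ?_) ⟨j, Finset.mem_univ j, ?_⟩) <;>
    rw [hadd, hx]
  · nlinarith [mul_nonneg (hpos i).le (sq_nonneg ((y ᵥ* V) i)), sq_nonneg ((y ᵥ* V) i)]
  · nlinarith [mul_pos (hpos j) (sq_pos_of_ne_zero hyj), sq_pos_of_ne_zero hyj]
  · nlinarith [mul_nonneg (hpos i).le (sq_nonneg ((y ᵥ* V) i)),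
      sq_nonneg (τ / lam i * (y ᵥ* V) i)]
  · nlinarith [mul_pos (hpos j) (sq_pos_of_ne_zero hyj), sq_nonneg (τ / lam j * (y ᵥ* V) j)]

theorem neg_inv_transpose_mulVec_vecMul {M : Matrix n n ℝ} (hM : IsUnit M) (a : n → ℝ) :
    (-((M⁻¹)ᵀ *ᵥ a)) ᵥ* M = -a := by
  rw [mulVec_transpose, neg_vecMul, vecMul_vecMul,
    nonsing_inv_mul _ ((isUnit_iff_isUnit_det M).mp hM), vecMul_one]

/-- The solution of the scaled pencil `(M + τ N K) C` lies strictly within the `V Vᵀ`-distance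
of the solutions for `M` and `N` from either of them. -/
theorem pencil_solution_mem_balls {M N K C V T : Matrix n n ℝ} {a b c : n → ℝ} {lam : n → ℝ}
    {τ : ℝ} (hτ : 0 < τ) (hlam : ∀ i, 0 < lam i)
    (hM : IsUnit M) (hN : IsUnit N) (hK : IsUnit K) (hC : IsUnit C) (hV : IsUnit V)
    (hT : IsUnit T) (hTeq : T = (M + τ • (N * K)) * C) (hc : c = (a + τ • (b ᵥ* K)) ᵥ* C)
    (hdiag : M * K⁻¹ * N⁻¹ = V * diagonal lam * V⁻¹)
    (hne : -((N⁻¹)ᵀ *ᵥ b) ≠ -((M⁻¹)ᵀ *ᵥ a)) :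
    let p := -((M⁻¹)ᵀ *ᵥ a)
    let q := -((N⁻¹)ᵀ *ᵥ b)
    let u := -((T⁻¹)ᵀ *ᵥ c)
    √((u - p) ⬝ᵥ ((V * Vᵀ) *ᵥ (u - p))) < √((q - p) ⬝ᵥ ((V * Vᵀ) *ᵥ (q - p))) ∧
      √((u - q) ⬝ᵥ ((V * Vᵀ) *ᵥ (u - q))) < √((q - p) ⬝ᵥ ((V * Vᵀ) *ᵥ (q - p))) := by
  intro p q u
  have hp : p ᵥ* M = -a := neg_inv_transpose_mulVec_vecMul hM a
  have hq : q ᵥ* N = -b := neg_inv_transpose_mulVec_vecMul hN b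
  have hu : u ᵥ* (M + τ • (N * K)) = -(a + τ • (b ᵥ* K)) := by
    apply vecMul_injective_of_isUnit hC
    simpa only [u, neg_vecMul, vecMul_vecMul, ← hTeq, ← hc] using
      neg_inv_transpose_mulVec_vecMul hT c
  have hbal : (u - p) ᵥ* M = τ • ((q - u) ᵥ* (N * K)) := by
    have hqK : q ᵥ* (N * K) = -(b ᵥ* K) := by rw [← vecMul_vecMul, hq, neg_vecMul]
    rw [vecMul_add, vecMul_smul] at hu
    rw [sub_vecMul, sub_vecMul, hp, hqK, eq_sub_of_add_eq hu, smul_sub, smul_neg]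
    abel
  have hdiag' : M * (K⁻¹ * N⁻¹ * V) = V * diagonal lam := by
    rw [← Matrix.mul_assoc, ← Matrix.mul_assoc, hdiag, Matrix.mul_assoc,
      nonsing_inv_mul _ ((isUnit_iff_isUnit_det V).mp hV), Matrix.mul_one]
  have hcancel : N * K * (K⁻¹ * N⁻¹ * V) = V := by
    rw [← Matrix.mul_inv_rev, ← Matrix.mul_assoc,
      mul_nonsing_inv _ ((isUnit_iff_isUnit_det _).mp (hN.mul hK)), Matrix.one_mul]
  have hcoord : ∀ i, lam i * ((u - p) ᵥ* V) i = τ * ((q - u) ᵥ* V) i := fun i => by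
    have := congrFun (congrArg (· ᵥ* (K⁻¹ * N⁻¹ * V)) hbal) i
    simp only [smul_vecMul, vecMul_vecMul, hdiag', hcancel] at this
    rw [← vecMul_vecMul, vecMul_diagonal] at this
    simpa [mul_comm] using this
  have hsum : (u - p) + (q - u) = q - p := by abel
  have := sqrt_sum_sq_vecMul_lt hV hlam hτ (by rw [hsum]; exact sub_ne_zero.mpr hne) hcoord
  rw [dotProduct_mulVec_sub_comm _ u q]
  simpa only [dotProduct_mul_transpose_mulVec_self, hsum] using this

end QuadraticForm

theorem isUnit_fromBlocks_smul_one {m n : Type*} [Fintype m] [DecidableEq m] [Fintype n]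
    [DecidableEq n] {x y : ℝ} (hx : x ≠ 0) (hy : y ≠ 0) :
    IsUnit (fromBlocks (x • 1) 0 0 (y • 1) : Matrix (m ⊕ n) (m ⊕ n) ℝ) := by
  simp [isUnit_iff_isUnit_det, hx, hy]

/-- (Joint four-ball bound) For `θ ∈ (0,π/2)²` with E1-coordinates `(φ,t)` and
E2-coordinates `(ψ,s)`, under positive real diagonalizability of `𝐌 H_φ⁻¹ 𝐍⁻¹` and
`M1 H_ψ⁻¹ M2⁻¹`, the SVO-Nash equilibrium `u_θ` lies in
`B_{P_φ}(u_N, r) ∩ B_{P_φ}(u_A, r) ∩ B_{P_ψ}(u₁, r') ∩ B_{P_ψ}(u₂, r')`. -/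
theorem stmt_8 {d1 d2 : ℕ} (hd1 : 1 ≤ d1) (hd2 : 1 ≤ d2)
    (A1 : Matrix (Fin d1) (Fin d1) ℝ) (A2 : Matrix (Fin d2) (Fin d2) ℝ)
    (D1 : Matrix (Fin d2) (Fin d2) ℝ) (D2 : Matrix (Fin d1) (Fin d1) ℝ)
    (B1 : Matrix (Fin d2) (Fin d1) ℝ) (B2 : Matrix (Fin d1) (Fin d2) ℝ)
    (a1 : Fin d1 → ℝ) (a2 : Fin d2 → ℝ) (b1 : Fin d2 → ℝ) (b2 : Fin d1 → ℝ)
    (θ1 θ2 φ t ψ s : ℝ)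
    (hθ1 : θ1 ∈ Set.Ioo 0 (Real.pi / 2)) (hθ2 : θ2 ∈ Set.Ioo 0 (Real.pi / 2))
    (hφ : φ ∈ Set.Ioo 0 (Real.pi / 2)) (ht : 0 < t)
    (hψ : ψ ∈ Set.Ioo 0 (Real.pi / 2)) (hs : 0 < s)
    (hφ1 : Real.tan θ1 = t * Real.cos φ) (hφ2 : Real.tan θ2 = t * Real.sin φ)
    (hψ1 : Real.tan θ1 = s * Real.cos ψ) (hψ2 : (Real.tan θ2)⁻¹ = s * Real.sin ψ)
    (Vφ Vψ : Matrix (Fin d1 ⊕ Fin d2) (Fin d1 ⊕ Fin d2) ℝ)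
    (hVφ : IsUnit Vφ) (hVψ : IsUnit Vψ)
    (lam mu : Fin d1 ⊕ Fin d2 → ℝ) (hlam : ∀ i, 0 < lam i) (hmu : ∀ i, 0 < mu i) :
    let M : Matrix (Fin d1 ⊕ Fin d2) (Fin d1 ⊕ Fin d2) ℝ := Matrix.fromBlocks A1 B2 B1 A2
    let N : Matrix (Fin d1 ⊕ Fin d2) (Fin d1 ⊕ Fin d2) ℝ := Matrix.fromBlocks D2 B1ᵀ B2ᵀ D1
    let M1 : Matrix (Fin d1 ⊕ Fin d2) (Fin d1 ⊕ Fin d2) ℝ := Matrix.fromBlocks A1 B1ᵀ B1 D1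
    let M2 : Matrix (Fin d1 ⊕ Fin d2) (Fin d1 ⊕ Fin d2) ℝ := Matrix.fromBlocks D2 B2 B2ᵀ A2
    let Mθ : Matrix (Fin d1 ⊕ Fin d2) (Fin d1 ⊕ Fin d2) ℝ :=
      Matrix.fromBlocks (Real.cos θ1 • A1 + Real.sin θ1 • D2)
        (Real.cos θ2 • B2 + Real.sin θ2 • B1ᵀ)
        (Real.cos θ1 • B1 + Real.sin θ1 • B2ᵀ)
        (Real.cos θ2 • A2 + Real.sin θ2 • D1)
    let aθ : Fin d1 ⊕ Fin d2 → ℝ :=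
      Sum.elim (Real.cos θ1 • a1 + Real.sin θ1 • b2) (Real.cos θ2 • a2 + Real.sin θ2 • b1)
    let Hφ : Matrix (Fin d1 ⊕ Fin d2) (Fin d1 ⊕ Fin d2) ℝ :=
      Matrix.fromBlocks (Real.cos φ • 1) 0 0 (Real.sin φ • 1)
    let Hψ : Matrix (Fin d1 ⊕ Fin d2) (Fin d1 ⊕ Fin d2) ℝ :=
      Matrix.fromBlocks (Real.cos ψ • 1) 0 0 (Real.sin ψ • 1)
    let uN : Fin d1 ⊕ Fin d2 → ℝ := -((M⁻¹)ᵀ *ᵥ Sum.elim a1 a2)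
    let uA : Fin d1 ⊕ Fin d2 → ℝ := -((N⁻¹)ᵀ *ᵥ Sum.elim b2 b1)
    let u1 : Fin d1 ⊕ Fin d2 → ℝ := -((M1⁻¹)ᵀ *ᵥ Sum.elim a1 b1)
    let u2 : Fin d1 ⊕ Fin d2 → ℝ := -((M2⁻¹)ᵀ *ᵥ Sum.elim b2 a2)
    let uθ : Fin d1 ⊕ Fin d2 → ℝ := -((Mθ⁻¹)ᵀ *ᵥ aθ)
    let Pφnorm : (Fin d1 ⊕ Fin d2 → ℝ) → ℝ := fun u => Real.sqrt (u ⬝ᵥ ((Vφ * Vφᵀ) *ᵥ u))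
    let Pψnorm : (Fin d1 ⊕ Fin d2 → ℝ) → ℝ := fun u => Real.sqrt (u ⬝ᵥ ((Vψ * Vψᵀ) *ᵥ u))
    let r : ℝ := Pφnorm (uA - uN)
    let r' : ℝ := Pψnorm (u1 - u2)
    M * Hφ⁻¹ * N⁻¹ = Vφ * Matrix.diagonal lam * Vφ⁻¹ →
      M1 * Hψ⁻¹ * M2⁻¹ = Vψ * Matrix.diagonal mu * Vψ⁻¹ →
      IsUnit M → IsUnit N → IsUnit M1 → IsUnit M2 → IsUnit Mθ →
      uA ≠ uN → u1 ≠ u2 →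
      Pφnorm (uθ - uN) < r ∧ Pφnorm (uθ - uA) < r ∧
        Pψnorm (uθ - u1) < r' ∧ Pψnorm (uθ - u2) < r' := by
  intro M N M1 M2 Mθ aθ Hφ Hψ uN uA u1 u2 uθ Pφnorm Pψnorm r r' hdφ hdψ hM hN hM1 hM2 hMθ
    hne hne'
  have hπ := Real.pi_pos
  have hc1 : 0 < Real.cos θ1 := Real.cos_pos_of_mem_Ioo ⟨by linarith [hθ1.1], hθ1.2⟩
  have hc2 : 0 < Real.cos θ2 := Real.cos_pos_of_mem_Ioo ⟨by linarith [hθ2.1], hθ2.2⟩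
  have hs2 : 0 < Real.sin θ2 := Real.sin_pos_of_pos_of_lt_pi hθ2.1 (by linarith [hθ2.2])
  have hcφ : 0 < Real.cos φ := Real.cos_pos_of_mem_Ioo ⟨by linarith [hφ.1], hφ.2⟩
  have hsφ : 0 < Real.sin φ := Real.sin_pos_of_pos_of_lt_pi hφ.1 (by linarith [hφ.2])
  have hcψ : 0 < Real.cos ψ := Real.cos_pos_of_mem_Ioo ⟨by linarith [hψ.1], hψ.2⟩
  have hsψ : 0 < Real.sin ψ := Real.sin_pos_of_pos_of_lt_pi hψ.1 (by linarith [hψ.2])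
  have e1 : Real.sin θ1 = Real.cos θ1 * (t * Real.cos φ) := by
    rw [← hφ1, mul_comm, Real.tan_mul_cos hc1.ne']
  have e2 : Real.sin θ2 = Real.cos θ2 * (t * Real.sin φ) := by
    rw [← hφ2, mul_comm, Real.tan_mul_cos hc2.ne']
  have e3 : Real.sin θ1 = Real.cos θ1 * (s * Real.cos ψ) := by
    rw [← hψ1, mul_comm, Real.tan_mul_cos hc1.ne']
  have e4 : Real.cos θ2 = Real.sin θ2 * (s * Real.sin ψ) := by
    rw [← hψ2, Real.tan_eq_sin_div_cos, inv_div, mul_div_cancel₀ _ hs2.ne']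
  have hφballs := pencil_solution_mem_balls (a := Sum.elim a1 a2) (b := Sum.elim b2 b1) (c := aθ)
    ht hlam hM hN (isUnit_fromBlocks_smul_one hcφ.ne' hsφ.ne')
    (isUnit_fromBlocks_smul_one hc1.ne' hc2.ne') hVφ hMθ
    (by
      simp only [Mθ, M, N, fromBlocks_multiply, fromBlocks_smul, fromBlocks_add]
      rw [e1, e2]
      simp [smul_smul, smul_add])
    (by
      simp only [aθ, vecMul_fromBlocks]
      rw [e1, e2]
      ext (i | i) <;> simp [vecMul_smul] <;> ring)
    hdφ hne
  have hψballs := pencil_solution_mem_balls (a := Sum.elim a1 b1) (b := Sum.elim b2 a2) (c := aθ)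
    hs hmu hM1 hM2 (isUnit_fromBlocks_smul_one hcψ.ne' hsψ.ne')
    (isUnit_fromBlocks_smul_one hc1.ne' hs2.ne') hVψ hMθ
    (by
      simp only [Mθ, M1, M2, fromBlocks_multiply, fromBlocks_smul, fromBlocks_add]
      rw [e3, e4]
      simp [smul_smul, smul_add, add_comm])
    (by
      simp only [aθ, vecMul_fromBlocks]
      rw [e3, e4]
      ext (i | i) <;> simp [vecMul_smul] <;> ring)
    hdψ hne'.symm
  have hr' : r' = Pψnorm (u2 - u1) := congrArg Real.sqrt (dotProduct_mulVec_sub_comm _ u1 u2)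
  rw [hr']
  exact ⟨hφballs.1, hφballs.2, hψballs.1, hψballs.2⟩
end

section
/- (Prosocial equilibrium inside the bound) Assume M1 and M2 are symmetric positive definite and u₁ ≠ u₂. Let θ = (π/4, π/4), and let V ∈ ℝ^{d×d} be any invertible matrix such that V⁻¹·(M1·M2⁻¹)·V is diagonal; set P = V·Vᵀ and r' = ‖u₁ − u₂‖_P. Then the SVO-Nash equilibrium u_θ (with 𝐌_θ invertible, which holds since M1, M2 ≻ 0) satisfies u_θ ∈ B_P(u₁, r') ∩ B_P(u₂, r'). -/
open Matrix

namespace Matrix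

variable {n : Type*} [Fintype n]

theorem dotProduct_mul_transpose_mulVec_self (V : Matrix n n ℝ) (u : n → ℝ) :
    u ⬝ᵥ ((V * Vᵀ) *ᵥ u) = ∑ i, (Vᵀ *ᵥ u) i ^ 2 := by
  rw [← mulVec_mulVec, dotProduct_mulVec, ← mulVec_transpose]
  simp only [dotProduct, sq]

variable [DecidableEq n]

/-- The entries of a diagonalization of `M * N⁻¹` are positive when `M` and `N` are positive
definite. -/
theorem PosDef.diagonalization_pos {M N V : Matrix n n ℝ} {l : n → ℝ} (hM : M.PosDef)
    (hN : N.PosDef) (hV : IsUnit V) (h : V⁻¹ * (M * N⁻¹) * V = diagonal l) (i : n) : 0 < l i := by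
  have hVdet := (isUnit_iff_isUnit_det V).1 hV
  have hVi : IsUnit V⁻¹ := isUnit_nonsing_inv_iff.2 hV
  have hinj : Function.Injective (V⁻¹).vecMul := vecMul_injective_of_isUnit hVi
  have key : V⁻¹ * M * (V⁻¹)ᴴ = diagonal l * (V⁻¹ * N * (V⁻¹)ᴴ) := by
    have hN' := (isUnit_iff_isUnit_det N).1 hN.isUnit
    rw [← h]
    simp only [Matrix.mul_assoc, mul_nonsing_inv_cancel_left _ _ hVdet,
      nonsing_inv_mul_cancel_left _ _ hN']
  have h1 := (hM.mul_mul_conjTranspose_same hinj).diag_pos (i := i)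
  have h2 := (hN.mul_mul_conjTranspose_same hinj).diag_pos (i := i)
  rw [key, diagonal_mul] at h1
  exact (pos_iff_pos_of_mul_pos h1).2 h2

theorem sqrt_quadForm_lt {V : Matrix n n ℝ} (hV : IsUnit V) {u w : n → ℝ} (hw : w ≠ 0)
    (h : ∀ i, ∃ t : ℝ, |t| < 1 ∧ (Vᵀ *ᵥ u) i = t * (Vᵀ *ᵥ w) i) :
    Real.sqrt (u ⬝ᵥ ((V * Vᵀ) *ᵥ u)) < Real.sqrt (w ⬝ᵥ ((V * Vᵀ) *ᵥ w)) := by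
  have hne : Vᵀ *ᵥ w ≠ 0 := fun h0 => hw <|
    mulVec_injective_of_isUnit ((isUnit_transpose V).2 hV) (h0.trans (mulVec_zero _).symm)
  obtain ⟨j, hj⟩ := Function.ne_iff.1 hne
  rw [dotProduct_mul_transpose_mulVec_self, dotProduct_mul_transpose_mulVec_self]
  refine Real.sqrt_lt_sqrt (Finset.sum_nonneg fun i _ => sq_nonneg _)
    (Finset.sum_lt_sum (fun i _ => ?_) ⟨j, Finset.mem_univ j, ?_⟩)
  · obtain ⟨t, ht, hi⟩ := h i
    rw [hi, mul_pow]
    exact mul_le_of_le_one_left (sq_nonneg _) ((sq_lt_one_iff_abs_lt_one t).2 ht).le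
  · obtain ⟨t, ht, hi⟩ := h j
    rw [hi, mul_pow]
    exact mul_lt_of_lt_one_left (sq_pos_of_ne_zero hj) ((sq_lt_one_iff_abs_lt_one t).2 ht)

/-- If `u` is the average of `u₁` and `u₂` weighted by positive definite matrices `M` and `N`,
and `V` diagonalizes `M * N⁻¹`, then `u` is closer to each of `u₁`, `u₂` than these are to each
other, in the norm of `V * Vᵀ`. -/
theorem PosDef.sqrt_quadForm_weightedAverage_lt {M N V : Matrix n n ℝ} (hM : M.PosDef)
    (hN : N.PosDef) (hV : IsUnit V) (hdiag : (V⁻¹ * (M * N⁻¹) * V).IsDiag) {u₁ u₂ u : n → ℝ}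
    (hne : u₁ ≠ u₂) (hu : (M + N) *ᵥ u = M *ᵥ u₁ + N *ᵥ u₂) :
    Real.sqrt ((u - u₁) ⬝ᵥ ((V * Vᵀ) *ᵥ (u - u₁))) <
        Real.sqrt ((u₁ - u₂) ⬝ᵥ ((V * Vᵀ) *ᵥ (u₁ - u₂))) ∧
      Real.sqrt ((u - u₂) ⬝ᵥ ((V * Vᵀ) *ᵥ (u - u₂))) <
        Real.sqrt ((u₁ - u₂) ⬝ᵥ ((V * Vᵀ) *ᵥ (u₁ - u₂))) := by
  obtain ⟨l, hl⟩ : ∃ l, V⁻¹ * (M * N⁻¹) * V = diagonal l := ⟨_, hdiag.diagonal_diag.symm⟩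
  have hpos := hM.diagonalization_pos hN hV hl
  have hVdet := (isUnit_iff_isUnit_det V).1 hV
  have hNdet := (isUnit_iff_isUnit_det N).1 hN.isUnit
  have hMt : Mᵀ = M := hM.isHermitian
  have hNt : Nᵀ = N := hN.isHermitian
  have hcomm : diagonal l * Vᵀ = Vᵀ * (N⁻¹ * M) := by
    have h : V * diagonal l = M * N⁻¹ * V := by
      rw [← hl, Matrix.mul_assoc, mul_nonsing_inv_cancel_left _ _ hVdet]
    simpa [transpose_mul, transpose_nonsing_inv, hMt, hNt] using congrArg Matrix.transpose h
  have hbal : (N⁻¹ * M) *ᵥ (u - u₁) = -(u - u₂) := by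
    have h : M *ᵥ (u - u₁) = N *ᵥ (-(u - u₂)) := by
      rw [add_mulVec] at hu
      rw [mulVec_neg, mulVec_sub, mulVec_sub]
      linear_combination hu
    rw [← mulVec_mulVec, h, mulVec_mulVec, nonsing_inv_mul _ hNdet, one_mulVec]
  have hcoord : ∀ i, l i * (Vᵀ *ᵥ (u - u₁)) i = -(Vᵀ *ᵥ (u - u₂)) i := fun i => by
    rw [← mulVec_diagonal, mulVec_mulVec, hcomm, ← mulVec_mulVec, hbal, mulVec_neg, Pi.neg_apply]
  have hdiff : ∀ i, (Vᵀ *ᵥ (u₁ - u₂)) i = (Vᵀ *ᵥ (u - u₂)) i - (Vᵀ *ᵥ (u - u₁)) i := fun i => by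
    rw [← Pi.sub_apply, ← mulVec_sub, sub_sub_sub_cancel_left]
  have hw := sub_ne_zero.2 hne
  refine ⟨sqrt_quadForm_lt hV hw fun i => ⟨-(1 / (1 + l i)), ?_, ?_⟩,
    sqrt_quadForm_lt hV hw fun i => ⟨l i / (1 + l i), ?_, ?_⟩⟩ <;> have hi := hpos i
  · rw [abs_neg, abs_of_pos (by positivity), div_lt_one (by positivity)]
    linarith
  · rw [hdiff]
    field_simp
    linear_combination hcoord i
  · rw [abs_of_pos (by positivity), div_lt_one (by positivity)]
    linarith
  · rw [hdiff]
    field_simp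
    linear_combination hcoord i

end Matrix

/-- (Prosocial equilibrium inside the bound) If `M1, M2` are symmetric positive definite,
`u₁ ≠ u₂`, `θ = (π/4, π/4)`, and `V` is invertible with `V⁻¹ (M1 M2⁻¹) V` diagonal, then
`𝐌_θ` is invertible and the SVO-Nash equilibrium `u_θ` lies in
`B_P(u₁, r') ∩ B_P(u₂, r')` with `P = V Vᵀ`, `r' = ‖u₁ - u₂‖_P`. -/
theorem stmt_10 {d1 d2 : ℕ} (hd1 : 1 ≤ d1) (hd2 : 1 ≤ d2)
    (A1 : Matrix (Fin d1) (Fin d1) ℝ) (A2 : Matrix (Fin d2) (Fin d2) ℝ)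
    (D1 : Matrix (Fin d2) (Fin d2) ℝ) (D2 : Matrix (Fin d1) (Fin d1) ℝ)
    (B1 : Matrix (Fin d2) (Fin d1) ℝ) (B2 : Matrix (Fin d1) (Fin d2) ℝ)
    (a1 : Fin d1 → ℝ) (a2 : Fin d2 → ℝ) (b1 : Fin d2 → ℝ) (b2 : Fin d1 → ℝ)
    (V : Matrix (Fin d1 ⊕ Fin d2) (Fin d1 ⊕ Fin d2) ℝ) (hV : IsUnit V) :
    let θ1 : ℝ := Real.pi / 4
    let θ2 : ℝ := Real.pi / 4
    let M1 : Matrix (Fin d1 ⊕ Fin d2) (Fin d1 ⊕ Fin d2) ℝ := Matrix.fromBlocks A1 B1ᵀ B1 D1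
    let M2 : Matrix (Fin d1 ⊕ Fin d2) (Fin d1 ⊕ Fin d2) ℝ := Matrix.fromBlocks D2 B2 B2ᵀ A2
    let Mθ : Matrix (Fin d1 ⊕ Fin d2) (Fin d1 ⊕ Fin d2) ℝ :=
      Matrix.fromBlocks (Real.cos θ1 • A1 + Real.sin θ1 • D2)
        (Real.cos θ2 • B2 + Real.sin θ2 • B1ᵀ)
        (Real.cos θ1 • B1 + Real.sin θ1 • B2ᵀ)
        (Real.cos θ2 • A2 + Real.sin θ2 • D1)
    let aθ : Fin d1 ⊕ Fin d2 → ℝ :=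
      Sum.elim (Real.cos θ1 • a1 + Real.sin θ1 • b2) (Real.cos θ2 • a2 + Real.sin θ2 • b1)
    let u1 : Fin d1 ⊕ Fin d2 → ℝ := -((M1⁻¹)ᵀ *ᵥ Sum.elim a1 b1)
    let u2 : Fin d1 ⊕ Fin d2 → ℝ := -((M2⁻¹)ᵀ *ᵥ Sum.elim b2 a2)
    let uθ : Fin d1 ⊕ Fin d2 → ℝ := -((Mθ⁻¹)ᵀ *ᵥ aθ)
    let Pnorm : (Fin d1 ⊕ Fin d2 → ℝ) → ℝ := fun u => Real.sqrt (u ⬝ᵥ ((V * Vᵀ) *ᵥ u))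
    let r' : ℝ := Pnorm (u1 - u2)
    M1.PosDef → M2.PosDef → (V⁻¹ * (M1 * M2⁻¹) * V).IsDiag → u1 ≠ u2 →
      IsUnit Mθ ∧ Pnorm (uθ - u1) < r' ∧ Pnorm (uθ - u2) < r' := by
  intro θ1 θ2 M1 M2 Mθ aθ u1 u2 uθ Pnorm r' hM1 hM2 hdiag hne
  have hc : (0 : ℝ) < √2 / 2 := by positivity
  have hMθ : Mθ = (√2 / 2 : ℝ) • (M1 + M2) := by
    simp only [Mθ, M1, M2, θ1, θ2, Real.cos_pi_div_four, Real.sin_pi_div_four, fromBlocks_add,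
      fromBlocks_smul, smul_add]
    congr 1 <;> exact add_comm _ _
  have haθ : aθ = (√2 / 2 : ℝ) • (Sum.elim a1 b1 + Sum.elim b2 a2) := by
    ext (i | i) <;> simp [aθ, θ1, θ2] <;> ring
  have hMθpos : Mθ.PosDef := hMθ ▸ (hM1.add hM2).smul hc
  have hsolve : ∀ {M : Matrix (Fin d1 ⊕ Fin d2) (Fin d1 ⊕ Fin d2) ℝ} (c), M.PosDef →
      M *ᵥ (-((M⁻¹)ᵀ *ᵥ c)) = -c := fun {M} c hM => by
    have hMt : Mᵀ = M := hM.isHermitian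
    rw [transpose_nonsing_inv, hMt, mulVec_neg, mulVec_mulVec,
      mul_nonsing_inv _ ((isUnit_iff_isUnit_det M).1 hM.isUnit), one_mulVec]
  refine ⟨hMθpos.isUnit, hM1.sqrt_quadForm_weightedAverage_lt hM2 hV hdiag hne ?_⟩
  have h : Mθ *ᵥ uθ = -aθ := hsolve aθ hMθpos
  rw [hMθ, haθ, smul_mulVec, ← smul_neg] at h
  rw [smul_right_injective _ hc.ne' h, hsolve _ hM1, hsolve _ hM2, neg_add]
end

section
/- (Alternative Nash expansion) Fix φ ∈ (0, π/2) and t > 0, and assume 𝐌, 𝐍, and (1/t)·𝐌·H_φ⁻¹·𝐍⁻¹ + I are invertible. Then t·𝐍·H_φ·𝐌⁻¹ + I is also invertible, and u_N + ((1/t)·𝐌·H_φ⁻¹·𝐍⁻¹ + I)⁻ᵀ·(u_A − u_N) = u_A + (t·𝐍·H_φ·𝐌⁻¹ + I)⁻ᵀ·(u_N − u_A). -/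
open Matrix

/-- If `X` and `Y` are mutually inverse and `X + 1` is invertible, then so is `Y + 1`, and the
inverses of `X + 1` and `Y + 1` add up to the identity. -/
theorem Matrix.isUnit_add_one_and_inv_add_inv_eq_one {n R : Type*} [Fintype n] [DecidableEq n]
    [CommRing R] {X Y : Matrix n n R} (hXY : X * Y = 1) (hX : IsUnit (X + 1)) :
    IsUnit (Y + 1) ∧ (X + 1)⁻¹ + (Y + 1)⁻¹ = 1 := by
  have hdet := (Matrix.isUnit_iff_isUnit_det _).mp hX
  have hmul : (X + 1)⁻¹ * X * (Y + 1) = 1 := by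
    rw [mul_assoc, mul_add, hXY, mul_one, add_comm 1 X, Matrix.nonsing_inv_mul _ hdet]
  refine ⟨IsUnit.of_mul_eq_one_right _ hmul, ?_⟩
  rw [Matrix.inv_eq_left_inv hmul]
  calc (X + 1)⁻¹ + (X + 1)⁻¹ * X = (X + 1)⁻¹ * (X + 1) := by rw [mul_add, mul_one, add_comm]
    _ = 1 := Matrix.nonsing_inv_mul _ hdet

/-- (Alternative Nash expansion) If `𝐌`, `𝐍`, and `(1/t)·𝐌·H_φ⁻¹·𝐍⁻¹ + I` are invertible,
then `t·𝐍·H_φ·𝐌⁻¹ + I` is invertible and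
`u_N + ((1/t)·𝐌·H_φ⁻¹·𝐍⁻¹ + I)⁻ᵀ (u_A - u_N) = u_A + (t·𝐍·H_φ·𝐌⁻¹ + I)⁻ᵀ (u_N - u_A)`. -/
theorem stmt_11 {d1 d2 : ℕ} (hd1 : 1 ≤ d1) (hd2 : 1 ≤ d2)
    (A1 : Matrix (Fin d1) (Fin d1) ℝ) (A2 : Matrix (Fin d2) (Fin d2) ℝ)
    (D1 : Matrix (Fin d2) (Fin d2) ℝ) (D2 : Matrix (Fin d1) (Fin d1) ℝ)
    (B1 : Matrix (Fin d2) (Fin d1) ℝ) (B2 : Matrix (Fin d1) (Fin d2) ℝ)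
    (a1 : Fin d1 → ℝ) (a2 : Fin d2 → ℝ) (b1 : Fin d2 → ℝ) (b2 : Fin d1 → ℝ)
    (φ t : ℝ) (hφ : φ ∈ Set.Ioo 0 (Real.pi / 2)) (ht : 0 < t) :
    let M : Matrix (Fin d1 ⊕ Fin d2) (Fin d1 ⊕ Fin d2) ℝ := Matrix.fromBlocks A1 B2 B1 A2
    let N : Matrix (Fin d1 ⊕ Fin d2) (Fin d1 ⊕ Fin d2) ℝ := Matrix.fromBlocks D2 B1ᵀ B2ᵀ D1
    let Hφ : Matrix (Fin d1 ⊕ Fin d2) (Fin d1 ⊕ Fin d2) ℝ :=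
      Matrix.fromBlocks (Real.cos φ • 1) 0 0 (Real.sin φ • 1)
    let uN : Fin d1 ⊕ Fin d2 → ℝ := -((M⁻¹)ᵀ *ᵥ Sum.elim a1 a2)
    let uA : Fin d1 ⊕ Fin d2 → ℝ := -((N⁻¹)ᵀ *ᵥ Sum.elim b2 b1)
    IsUnit M → IsUnit N →
      IsUnit ((1 / t) • (M * Hφ⁻¹ * N⁻¹) + 1) →
      IsUnit (t • (N * Hφ * M⁻¹) + 1) ∧
        uN + (((1 / t) • (M * Hφ⁻¹ * N⁻¹) + 1)⁻¹)ᵀ *ᵥ (uA - uN) =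
          uA + ((t • (N * Hφ * M⁻¹) + 1)⁻¹)ᵀ *ᵥ (uN - uA) := by
  intro M N Hφ uN uA hM hN hX
  have hMdet := (Matrix.isUnit_iff_isUnit_det _).mp hM
  have hNdet := (Matrix.isUnit_iff_isUnit_det _).mp hN
  have hcos : Real.cos φ ≠ 0 :=
    (Real.cos_pos_of_mem_Ioo ⟨by linarith [hφ.1, Real.pi_pos], hφ.2⟩).ne'
  have hsin : Real.sin φ ≠ 0 :=
    (Real.sin_pos_of_pos_of_lt_pi hφ.1 (by linarith [hφ.2, Real.pi_pos])).ne'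
  have hHdet : IsUnit Hφ.det := by
    simp [Hφ, Matrix.det_fromBlocks_zero₂₁, hcos, hsin]
  have hXY : ((1 / t) • (M * Hφ⁻¹ * N⁻¹)) * (t • (N * Hφ * M⁻¹)) = 1 := by
    have h : M * Hφ⁻¹ * N⁻¹ * (N * Hφ * M⁻¹) = 1 := by
      simp only [mul_assoc]
      rw [Matrix.nonsing_inv_mul_cancel_left _ _ hNdet,
        Matrix.nonsing_inv_mul_cancel_left _ _ hHdet, Matrix.mul_nonsing_inv _ hMdet]
    rw [smul_mul_smul_comm, h, one_div, inv_mul_cancel₀ ht.ne', one_smul]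
  obtain ⟨hY, hsum⟩ := Matrix.isUnit_add_one_and_inv_add_inv_eq_one hXY hX
  refine ⟨hY, ?_⟩
  rw [eq_sub_of_add_eq hsum, Matrix.transpose_sub, Matrix.transpose_one, Matrix.sub_mulVec,
    Matrix.one_mulVec, ← neg_sub uA uN, Matrix.mulVec_neg]
  abel
end

section
/- (Asymptotic blow-up direction) Assume 𝐌·H_φ⁻¹·𝐍⁻¹ = V·diag(λ_1,…,λ_d)·V⁻¹ with V ∈ ℝ^{d×d} invertible and all λ_i real, and suppose λ_j < 0 for some index j. Let W_i denote the i-th column of V⁻ᵀ and V_i the i-th column of V, and for t > 0 with λ_i + t ≠ 0 for all i let Γ_φ(t) = u_N + ((1/t)·𝐌·H_φ⁻¹·𝐍⁻¹ + I)⁻ᵀ·(u_A − u_N). Then, as t → |λ_j| within {t > 0 : λ_i + t ≠ 0 for all i}, (1 + λ_j/t)·(Γ_φ(t) − u_N) converges to Σ_{i : λ_i = λ_j} W_i·V_iᵀ·(u_A − u_N). -/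
open Matrix Filter Topology

theorem inv_smul_diagonalized_add_one {n K : Type*} [Fintype n] [DecidableEq n] [Field K]
    {V : Matrix n n K} (hV : IsUnit V) {lam : n → K} {s : K} (hs : ∀ i, 1 + s * lam i ≠ 0) :
    (s • (V * diagonal lam * V⁻¹) + 1)⁻¹ =
      V * diagonal (fun i => (1 + s * lam i)⁻¹) * V⁻¹ := by
  have hdet : IsUnit V.det := (isUnit_iff_isUnit_det V).1 hV
  have hsum : s • (V * diagonal lam * V⁻¹) + 1 =
      V * diagonal (fun i => 1 + s * lam i) * V⁻¹ := by
    have hdiag : diagonal (fun i => 1 + s * lam i) = 1 + s • diagonal lam := by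
      rw [← diagonal_one, ← diagonal_smul, diagonal_add]
      rfl
    rw [hdiag, mul_add, add_mul, mul_one, mul_nonsing_inv V hdet,
      Matrix.mul_smul, Matrix.smul_mul, add_comm]
  refine inv_eq_right_inv ?_
  calc _ = V * diagonal (fun i => 1 + s * lam i) * (V⁻¹ * V) *
        diagonal (fun i => (1 + s * lam i)⁻¹) * V⁻¹ := by
        rw [hsum]; simp only [Matrix.mul_assoc]
    _ = 1 := by
        rw [nonsing_inv_mul V hdet, mul_one, Matrix.mul_assoc V, diagonal_mul_diagonal]
        simp [hs, mul_nonsing_inv V hdet]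

theorem transpose_mul_diagonal_mul_mulVec {n R : Type*} [Fintype n] [DecidableEq n] [CommRing R]
    (V W : Matrix n n R) (d x : n → R) :
    (V * diagonal d * W)ᵀ *ᵥ x = ∑ i, (d i * ((fun k => V k i) ⬝ᵥ x)) • (fun k => W i k) := by
  ext k
  rw [transpose_mul, transpose_mul, diagonal_transpose, ← mulVec_mulVec, ← mulVec_mulVec]
  simp only [mulVec, dotProduct, Finset.sum_apply, Pi.smul_apply, smul_eq_mul,
    transpose_apply, diagonal_apply, ite_mul, zero_mul, Finset.sum_ite_eq, Finset.mem_univ,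
    if_true]
  exact Finset.sum_congr rfl fun i _ => mul_comm _ _

theorem tendsto_one_add_div_mul_inv {a b : ℝ} (hb : b < 0) {s : Set ℝ}
    (hs : ∀ t ∈ s, 0 < t ∧ b + t ≠ 0) :
    Tendsto (fun t : ℝ => (1 + b / t) * (1 + 1 / t * a)⁻¹) (𝓝[s] |b|)
      (𝓝 (if a = b then 1 else 0)) := by
  split_ifs with h
  · subst h
    refine tendsto_const_nhds.congr' ?_
    filter_upwards [self_mem_nhdsWithin] with t ht
    obtain ⟨ht0, hat⟩ := hs t ht
    have : t + a ≠ 0 := by rwa [add_comm]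
    field_simp
  · have habs : |b| = -b := abs_of_neg hb
    have hb0 : |b| ≠ 0 := abs_ne_zero.2 hb.ne
    have hden : 1 + 1 / |b| * a ≠ 0 := by
      rw [habs]
      intro h0
      field_simp at h0
      exact h (by linarith [(div_eq_one_iff_eq hb.ne).1 (by linarith : a / b = 1)])
    have hcont : ContinuousAt (fun t : ℝ => (1 + b / t) * (1 + 1 / t * a)⁻¹) |b| := by
      fun_prop (disch := assumption)
    convert hcont.tendsto.mono_left nhdsWithin_le_nhds using 2
    rw [habs, div_neg, div_self hb.ne, add_neg_cancel, zero_mul]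

/-- (Asymptotic blow-up direction) If `𝐌 H_φ⁻¹ 𝐍⁻¹ = V diag(λ) V⁻¹` with all `λᵢ` real and
`λⱼ < 0`, then as `t → |λⱼ|` within `{t > 0 : λᵢ + t ≠ 0 ∀i}`,
`(1 + λⱼ/t)·(Γ_φ(t) - u_N)` converges to `Σ_{i : λᵢ = λⱼ} Wᵢ Vᵢᵀ (u_A - u_N)`. -/
theorem stmt_12 {d1 d2 : ℕ} (hd1 : 1 ≤ d1) (hd2 : 1 ≤ d2)
    (A1 : Matrix (Fin d1) (Fin d1) ℝ) (A2 : Matrix (Fin d2) (Fin d2) ℝ)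
    (D1 : Matrix (Fin d2) (Fin d2) ℝ) (D2 : Matrix (Fin d1) (Fin d1) ℝ)
    (B1 : Matrix (Fin d2) (Fin d1) ℝ) (B2 : Matrix (Fin d1) (Fin d2) ℝ)
    (a1 : Fin d1 → ℝ) (a2 : Fin d2 → ℝ) (b1 : Fin d2 → ℝ) (b2 : Fin d1 → ℝ)
    (φ : ℝ) (hφ : φ ∈ Set.Ioo 0 (Real.pi / 2))
    (V : Matrix (Fin d1 ⊕ Fin d2) (Fin d1 ⊕ Fin d2) ℝ) (hV : IsUnit V)
    (lam : Fin d1 ⊕ Fin d2 → ℝ) (j : Fin d1 ⊕ Fin d2) (hj : lam j < 0) :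
    let M : Matrix (Fin d1 ⊕ Fin d2) (Fin d1 ⊕ Fin d2) ℝ := Matrix.fromBlocks A1 B2 B1 A2
    let N : Matrix (Fin d1 ⊕ Fin d2) (Fin d1 ⊕ Fin d2) ℝ := Matrix.fromBlocks D2 B1ᵀ B2ᵀ D1
    let Hφ : Matrix (Fin d1 ⊕ Fin d2) (Fin d1 ⊕ Fin d2) ℝ :=
      Matrix.fromBlocks (Real.cos φ • 1) 0 0 (Real.sin φ • 1)
    let uN : Fin d1 ⊕ Fin d2 → ℝ := -((M⁻¹)ᵀ *ᵥ Sum.elim a1 a2)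
    let uA : Fin d1 ⊕ Fin d2 → ℝ := -((N⁻¹)ᵀ *ᵥ Sum.elim b2 b1)
    let Γ : ℝ → (Fin d1 ⊕ Fin d2 → ℝ) := fun t =>
      uN + (((1 / t) • (M * Hφ⁻¹ * N⁻¹) + 1)⁻¹)ᵀ *ᵥ (uA - uN)
    IsUnit M → IsUnit N →
      M * Hφ⁻¹ * N⁻¹ = V * Matrix.diagonal lam * V⁻¹ →
      Filter.Tendsto (fun t : ℝ => (1 + lam j / t) • (Γ t - uN))
        (nhdsWithin |lam j| {t : ℝ | 0 < t ∧ ∀ i, lam i + t ≠ 0})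
        (nhds (∑ i ∈ Finset.univ.filter (fun i => lam i = lam j),
          ((fun k => V k i) ⬝ᵥ (uA - uN)) • (fun k => V⁻¹ i k))) := by
  intro M N Hφ uN uA Γ _ _ hdiag
  have hlim : Tendsto (fun t : ℝ => ∑ i, ((1 + lam j / t) * (1 + 1 / t * lam i)⁻¹) •
        (((fun k => V k i) ⬝ᵥ (uA - uN)) • (fun k => V⁻¹ i k)))
      (𝓝[{t : ℝ | 0 < t ∧ ∀ i, lam i + t ≠ 0}] |lam j|)
      (𝓝 (∑ i, (if lam i = lam j then (1 : ℝ) else 0) •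
        (((fun k => V k i) ⬝ᵥ (uA - uN)) • (fun k => V⁻¹ i k)))) :=
    tendsto_finsetSum _ fun i _ =>
      (tendsto_one_add_div_mul_inv hj fun t ht => ⟨ht.1, ht.2 j⟩).smul_const _
  simp only [ite_smul, one_smul, zero_smul, ← Finset.sum_filter] at hlim
  refine hlim.congr' ?_
  filter_upwards [self_mem_nhdsWithin] with t ht
  have hne : ∀ i, 1 + 1 / t * lam i ≠ 0 := fun i h0 => ht.2 i (by
    have ht0 : t ≠ 0 := ht.1.ne'
    field_simp at h0
    linarith)
  simp only [Γ, add_sub_cancel_left]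
  rw [hdiag, inv_smul_diagonalized_add_one hV hne, transpose_mul_diagonal_mul_mulVec,
    Finset.smul_sum]
  simp only [smul_smul, mul_assoc]
end

section
/- (Unbounded SVO equilibria) Assume 𝐌·H_φ⁻¹·𝐍⁻¹ = V·diag(λ_1,…,λ_d)·V⁻¹ with V ∈ ℝ^{d×d} invertible and all λ_i real, and suppose λ_j < 0 for some index j. Let W_i denote the i-th column of V⁻ᵀ and V_i the i-th column of V, and for t > 0 with λ_i + t ≠ 0 for all i let Γ_φ(t) = u_N + ((1/t)·𝐌·H_φ⁻¹·𝐍⁻¹ + I)⁻ᵀ·(u_A − u_N). If Σ_{i : λ_i = λ_j} W_i·V_iᵀ·(u_A − u_N) ≠ 0, then ‖Γ_φ(t)‖ → ∞ as t → |λ_j| within {t > 0 : λ_i + t ≠ 0 for all i}. -/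
open Matrix
open Filter Topology

/-- The shifted inverse of a diagonalized matrix, in the same eigenbasis. -/
lemma inv_smul_conj_diagonal_add_one {n : Type*} [Fintype n] [DecidableEq n]
    {V : Matrix n n ℝ} (hV : IsUnit V) {lam : n → ℝ} {t : ℝ} (ht : t ≠ 0)
    (hlam : ∀ i, lam i + t ≠ 0) :
    ((1 / t) • (V * diagonal lam * V⁻¹) + 1)⁻¹ =
      V * diagonal (fun i => t / (lam i + t)) * V⁻¹ := by
  have hdet : IsUnit V.det := (isUnit_iff_isUnit_det V).mp hV
  have hsum : (1 / t) • (V * diagonal lam * V⁻¹) + 1 =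
      V * diagonal (fun i => (lam i + t) / t) * V⁻¹ := by
    have hd : diagonal (fun i => (lam i + t) / t) = (1 / t) • diagonal lam + 1 := by
      rw [← diagonal_smul, ← diagonal_one, diagonal_add]
      congr 1
      ext i
      simp only [Pi.smul_apply, smul_eq_mul]
      field_simp
    rw [hd, mul_add, add_mul, mul_one, mul_nonsing_inv V hdet, mul_smul_comm, smul_mul_assoc]
  apply inv_eq_right_inv
  rw [hsum]
  calc V * diagonal (fun i => (lam i + t) / t) * V⁻¹ *
        (V * diagonal (fun i => t / (lam i + t)) * V⁻¹)
      = V * diagonal (fun i => (lam i + t) / t) * (V⁻¹ * V) *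
        diagonal (fun i => t / (lam i + t)) * V⁻¹ := by simp only [Matrix.mul_assoc]
    _ = V * (diagonal (fun i => (lam i + t) / t) * diagonal (fun i => t / (lam i + t))) *
        V⁻¹ := by rw [nonsing_inv_mul V hdet, mul_one, Matrix.mul_assoc V]
    _ = 1 := by
      have hone : (fun i => (lam i + t) / t * (t / (lam i + t))) = fun _ => 1 := by
        ext i
        have := hlam i
        field_simp
      rw [diagonal_mul_diagonal, hone, diagonal_one, mul_one, mul_nonsing_inv V hdet]

lemma transpose_mul_diagonal_mul_mulVec_apply {n : Type*} [Fintype n] [DecidableEq n]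
    (V W : Matrix n n ℝ) (μ w : n → ℝ) (k : n) :
    ((V * diagonal μ * W)ᵀ *ᵥ w) k = ∑ i, ((fun l => V l i) ⬝ᵥ w) * W i k * μ i := by
  rw [transpose_mul, transpose_mul, diagonal_transpose, ← mulVec_mulVec, ← mulVec_mulVec]
  refine Finset.sum_congr rfl fun i _ => ?_
  rw [mulVec_diagonal]
  change W i k * (μ i * ((fun l => V l i) ⬝ᵥ w)) = _
  ring

/-- A sum of simple fractions `t / (lam i + t)` blows up at a pole `-lam j` at which the
coefficients do not cancel. -/
lemma tendsto_abs_add_sum_div_add_atTop {n : Type*} [Fintype n] (lam a : n → ℝ) (c : ℝ) (j : n)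
    (hj : lam j ≠ 0) (ha : ∑ i with lam i = lam j, a i ≠ 0) :
    Tendsto (fun t => |c + ∑ i, a i * (t / (lam i + t))|) (𝓝[≠] (-lam j)) atTop := by
  classical
  set s := ∑ i with lam i = lam j, a i with hs
  have hcont : ContinuousAt (fun t => (lam j + t) *
      (c + ∑ i with lam i ≠ lam j, a i * (t / (lam i + t))) + t * s) (-lam j) := by
    refine ((continuousAt_const.add continuousAt_id).mul (continuousAt_const.add ?_)).add
      (continuousAt_id.mul continuousAt_const)
    refine tendsto_finsetSum _ fun i hi => ?_
    refine continuousAt_const.mul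
      (continuousAt_id.div (continuousAt_const.add continuousAt_id) ?_)
    change lam i + -lam j ≠ 0
    rw [← sub_eq_add_neg]
    exact sub_ne_zero.mpr (Finset.mem_filter.mp hi).2
  have hnum := (hcont.tendsto.mono_left (nhdsWithin_le_nhds (s := {-lam j}ᶜ))).abs
  have hpole : Tendsto (fun t => lam j + t) (𝓝[≠] (-lam j)) (𝓝[≠] 0) := by
    refine tendsto_nhdsWithin_iff.mpr ⟨?_, ?_⟩
    · have : ContinuousAt (fun t => lam j + t) (-lam j) := by fun_prop
      simpa using this.tendsto.mono_left nhdsWithin_le_nhds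
    · filter_upwards [self_mem_nhdsWithin] with t ht h
      exact ht (eq_neg_of_add_eq_zero_right h)
  have hpos : 0 < |(lam j + -lam j) * (c + ∑ i with lam i ≠ lam j,
      a i * (-lam j / (lam i + -lam j))) + -lam j * s| := by
    rw [add_neg_cancel, zero_mul, zero_add]
    exact abs_pos.mpr (mul_ne_zero (neg_ne_zero.mpr hj) ha)
  refine (hnum.pos_mul_atTop hpos (tendsto_norm_inv_nhdsNE_zero_atTop.comp hpole)).congr' ?_
  filter_upwards [self_mem_nhdsWithin] with t ht
  have hne : lam j + t ≠ 0 := fun h => ht (eq_neg_of_add_eq_zero_right h)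
  have hsing : ∑ i with lam i = lam j, a i * (t / (lam i + t)) = s * (t / (lam j + t)) := by
    rw [hs, Finset.sum_mul]
    exact Finset.sum_congr rfl fun i hi => by rw [(Finset.mem_filter.mp hi).2]
  rw [Function.comp_apply, Real.norm_eq_abs, ← abs_mul,
    ← Finset.sum_filter_add_sum_filter_not Finset.univ (fun i => lam i = lam j), hsing]
  congr 1
  field_simp
  ring

/-- (Unbounded SVO equilibria) If `𝐌 H_φ⁻¹ 𝐍⁻¹ = V diag(λ) V⁻¹` with all `λᵢ` real,
`λⱼ < 0`, and the blow-up direction `Σ_{i : λᵢ = λⱼ} Wᵢ Vᵢᵀ (u_A - u_N)` is nonzero, then the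
Euclidean norm of `Γ_φ(t)` tends to `∞` as `t → |λⱼ|` within `{t > 0 : λᵢ + t ≠ 0 ∀i}`. -/
theorem stmt_13 {d1 d2 : ℕ} (hd1 : 1 ≤ d1) (hd2 : 1 ≤ d2)
    (A1 : Matrix (Fin d1) (Fin d1) ℝ) (A2 : Matrix (Fin d2) (Fin d2) ℝ)
    (D1 : Matrix (Fin d2) (Fin d2) ℝ) (D2 : Matrix (Fin d1) (Fin d1) ℝ)
    (B1 : Matrix (Fin d2) (Fin d1) ℝ) (B2 : Matrix (Fin d1) (Fin d2) ℝ)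
    (a1 : Fin d1 → ℝ) (a2 : Fin d2 → ℝ) (b1 : Fin d2 → ℝ) (b2 : Fin d1 → ℝ)
    (φ : ℝ) (hφ : φ ∈ Set.Ioo 0 (Real.pi / 2))
    (V : Matrix (Fin d1 ⊕ Fin d2) (Fin d1 ⊕ Fin d2) ℝ) (hV : IsUnit V)
    (lam : Fin d1 ⊕ Fin d2 → ℝ) (j : Fin d1 ⊕ Fin d2) (hj : lam j < 0) :
    let M : Matrix (Fin d1 ⊕ Fin d2) (Fin d1 ⊕ Fin d2) ℝ := Matrix.fromBlocks A1 B2 B1 A2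
    let N : Matrix (Fin d1 ⊕ Fin d2) (Fin d1 ⊕ Fin d2) ℝ := Matrix.fromBlocks D2 B1ᵀ B2ᵀ D1
    let Hφ : Matrix (Fin d1 ⊕ Fin d2) (Fin d1 ⊕ Fin d2) ℝ :=
      Matrix.fromBlocks (Real.cos φ • 1) 0 0 (Real.sin φ • 1)
    let uN : Fin d1 ⊕ Fin d2 → ℝ := -((M⁻¹)ᵀ *ᵥ Sum.elim a1 a2)
    let uA : Fin d1 ⊕ Fin d2 → ℝ := -((N⁻¹)ᵀ *ᵥ Sum.elim b2 b1)
    let Γ : ℝ → (Fin d1 ⊕ Fin d2 → ℝ) := fun t =>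
      uN + (((1 / t) • (M * Hφ⁻¹ * N⁻¹) + 1)⁻¹)ᵀ *ᵥ (uA - uN)
    IsUnit M → IsUnit N →
      M * Hφ⁻¹ * N⁻¹ = V * Matrix.diagonal lam * V⁻¹ →
      (∑ i ∈ Finset.univ.filter (fun i => lam i = lam j),
          ((fun k => V k i) ⬝ᵥ (uA - uN)) • (fun k => V⁻¹ i k)) ≠ 0 →
      Filter.Tendsto (fun t : ℝ => Real.sqrt (∑ k, (Γ t k) ^ 2))
        (nhdsWithin |lam j| {t : ℝ | 0 < t ∧ ∀ i, lam i + t ≠ 0})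
        Filter.atTop := by
  intro M N Hφ uN uA Γ _ _ hdiag hne
  obtain ⟨k, hk⟩ := Function.ne_iff.mp hne
  rw [Finset.sum_apply] at hk
  simp only [Pi.smul_apply, smul_eq_mul, Pi.zero_apply] at hk
  have hblow := tendsto_abs_add_sum_div_add_atTop lam
    (fun i => ((fun l => V l i) ⬝ᵥ (uA - uN)) * V⁻¹ i k) (uN k) j hj.ne hk
  rw [abs_of_neg hj]
  have hsub : {t : ℝ | 0 < t ∧ ∀ i, lam i + t ≠ 0} ⊆ {-lam j}ᶜ := by
    rintro t ⟨-, ht⟩ rfl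
    exact ht j (add_neg_cancel _)
  refine tendsto_atTop_mono' _ ?_ (hblow.mono_left (nhdsWithin_mono _ hsub))
  filter_upwards [self_mem_nhdsWithin] with t ht
  have hΓ : Γ t k = uN k + ∑ i, ((fun l => V l i) ⬝ᵥ (uA - uN)) * V⁻¹ i k *
      (t / (lam i + t)) := by
    simp only [Γ]
    rw [Pi.add_apply, hdiag, inv_smul_conj_diagonal_add_one hV ht.1.ne' ht.2,
      transpose_mul_diagonal_mul_mulVec_apply]
  rw [← hΓ]
  exact Real.abs_le_sqrt
    (Finset.single_le_sum (f := fun l => Γ t l ^ 2) (fun l _ => sq_nonneg _) (Finset.mem_univ k))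
end

section
/- (SVO first-order optimality) Assume A1, A2, D1, D2 are symmetric and 𝐌_θ is invertible, and let θ = (θ1, θ2) ∈ ℝ². Define the SVO costs 𝐉_1(u) = cosθ1·J_1(u) + sinθ1·J_2(u) and 𝐉_2(u) = cosθ2·J_2(u) + sinθ2·J_1(u). Then the SVO-Nash equilibrium u_θ = −𝐌_θ⁻ᵀ𝐚_θ satisfies the first-order conditions of both players: writing u_θ = (u_θ¹, u_θ²) with u_θ¹ ∈ ℝ^{d1}, u_θ² ∈ ℝ^{d2}, the function v ↦ 𝐉_1((v, u_θ²)) has derivative zero at v = u_θ¹, and the function w ↦ 𝐉_2((u_θ¹, w)) has derivative zero at w = u_θ². -/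
open Matrix

/-- A quadratic form on `ℝⁿ` is stationary at the origin. -/
theorem hasFDerivAt_dotProduct_mulVec_zero {n : Type*} [Fintype n] (S : Matrix n n ℝ) :
    HasFDerivAt (fun v : n → ℝ => v ⬝ᵥ (S *ᵥ v)) (0 : (n → ℝ) →L[ℝ] ℝ) 0 := by
  have hcoord (i : n) :
      HasFDerivAt (fun v : n → ℝ => v i * (S *ᵥ v) i) (0 : (n → ℝ) →L[ℝ] ℝ) 0 := by
    have h1 : HasFDerivAt (fun v : n → ℝ => v i) (ContinuousLinearMap.proj i) 0 :=
      (ContinuousLinearMap.proj (R := ℝ) (φ := fun _ : n => ℝ) i).hasFDerivAt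
    have h2 : DifferentiableAt ℝ (fun v : n → ℝ => (S *ᵥ v) i) 0 := by
      simp only [mulVec, dotProduct]
      fun_prop
    simpa using h1.fun_mul h2.hasFDerivAt
  simpa [dotProduct] using HasFDerivAt.fun_sum (u := Finset.univ) fun i _ => hcoord i

/-- A critical point of a quadratic function with symmetric Hessian `S`. -/
theorem hasFDerivAt_quadratic_of_stationary {n : Type*} [Fintype n] {S : Matrix n n ℝ}
    (hS : S.IsSymm) (g : n → ℝ) (k : ℝ) {x : n → ℝ} (hx : S *ᵥ x + g = 0) :
    HasFDerivAt (fun v : n → ℝ => (1 / 2) * (v ⬝ᵥ (S *ᵥ v)) + g ⬝ᵥ v + k)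
      (0 : (n → ℝ) →L[ℝ] ℝ) x := by
  obtain rfl : g = -(S *ᵥ x) := eq_neg_of_add_eq_zero_right hx
  have hsymm (v w : n → ℝ) : w ⬝ᵥ (S *ᵥ v) = v ⬝ᵥ (S *ᵥ w) := by
    rw [dotProduct_mulVec, ← mulVec_transpose, hS.eq, dotProduct_comm]
  have hcomplete : (fun v : n → ℝ => (1 / 2) * (v ⬝ᵥ (S *ᵥ v)) + -(S *ᵥ x) ⬝ᵥ v + k) =
      fun v => (1 / 2) * ((v - x) ⬝ᵥ (S *ᵥ (v - x))) + (k - (1 / 2) * (x ⬝ᵥ (S *ᵥ x))) := by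
    funext v
    simp only [mulVec_sub, dotProduct_sub, sub_dotProduct, neg_dotProduct, hsymm v x,
      dotProduct_comm (S *ᵥ x) v]
    ring
  have h0 : HasFDerivAt (fun v : n → ℝ => v ⬝ᵥ (S *ᵥ v)) (0 : (n → ℝ) →L[ℝ] ℝ) (x - x) := by
    simpa using hasFDerivAt_dotProduct_mulVec_zero S
  have hshift : HasFDerivAt (fun v : n → ℝ => (v - x) ⬝ᵥ (S *ᵥ (v - x)))
      (0 : (n → ℝ) →L[ℝ] ℝ) x := by
    simpa [Function.comp_def] using
      HasFDerivAt.comp (f := fun v => v - x) x h0 ((hasFDerivAt_id x).sub_const x)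
  rw [hcomplete]
  simpa using (hshift.const_mul (1 / 2)).add_const (k - (1 / 2) * (x ⬝ᵥ (S *ᵥ x)))

/-- Expansion of a quadratic function along a block decomposition of the variables. -/
theorem quadratic_fromBlocks {m n : Type*} [Fintype m] [Fintype n]
    (A : Matrix m m ℝ) (B : Matrix m n ℝ) (D : Matrix n n ℝ) (a v : m → ℝ) (b w : n → ℝ) :
    (1 / 2) * (Sum.elim v w ⬝ᵥ (fromBlocks A B Bᵀ D *ᵥ Sum.elim v w)) +
        Sum.elim a b ⬝ᵥ Sum.elim v w =
      (1 / 2) * (v ⬝ᵥ (A *ᵥ v)) + v ⬝ᵥ (B *ᵥ w) + (1 / 2) * (w ⬝ᵥ (D *ᵥ w)) +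
        a ⬝ᵥ v + b ⬝ᵥ w := by
  have hB : w ⬝ᵥ (Bᵀ *ᵥ v) = v ⬝ᵥ (B *ᵥ w) := by
    rw [mulVec_transpose, dotProduct_comm, dotProduct_mulVec]
  simp only [fromBlocks_mulVec, sumElim_dotProduct_sumElim, dotProduct_add, hB,
    Sum.elim_comp_inl, Sum.elim_comp_inr]
  ring

/-- (SVO first-order optimality) With symmetric `A1, A2, D1, D2` and `𝐌_θ` invertible, the
SVO-Nash equilibrium `u_θ = -𝐌_θ⁻ᵀ 𝐚_θ` satisfies the first-order conditions of both
players for the SVO costs `𝐉₁ = cosθ1·J₁ + sinθ1·J₂` and `𝐉₂ = cosθ2·J₂ + sinθ2·J₁`. -/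
theorem stmt_15 {d1 d2 : ℕ} (hd1 : 1 ≤ d1) (hd2 : 1 ≤ d2)
    (A1 : Matrix (Fin d1) (Fin d1) ℝ) (A2 : Matrix (Fin d2) (Fin d2) ℝ)
    (D1 : Matrix (Fin d2) (Fin d2) ℝ) (D2 : Matrix (Fin d1) (Fin d1) ℝ)
    (B1 : Matrix (Fin d2) (Fin d1) ℝ) (B2 : Matrix (Fin d1) (Fin d2) ℝ)
    (a1 : Fin d1 → ℝ) (a2 : Fin d2 → ℝ) (b1 : Fin d2 → ℝ) (b2 : Fin d1 → ℝ)
    (hA1 : A1.IsSymm) (hA2 : A2.IsSymm) (hD1 : D1.IsSymm) (hD2 : D2.IsSymm)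
    (θ1 θ2 : ℝ) :
    let M1 : Matrix (Fin d1 ⊕ Fin d2) (Fin d1 ⊕ Fin d2) ℝ := Matrix.fromBlocks A1 B1ᵀ B1 D1
    let M2 : Matrix (Fin d1 ⊕ Fin d2) (Fin d1 ⊕ Fin d2) ℝ := Matrix.fromBlocks D2 B2 B2ᵀ A2
    let c1 : Fin d1 ⊕ Fin d2 → ℝ := Sum.elim a1 b1
    let c2 : Fin d1 ⊕ Fin d2 → ℝ := Sum.elim b2 a2
    let J1 : (Fin d1 ⊕ Fin d2 → ℝ) → ℝ := fun u => (1 / 2) * (u ⬝ᵥ (M1 *ᵥ u)) + c1 ⬝ᵥ u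
    let J2 : (Fin d1 ⊕ Fin d2 → ℝ) → ℝ := fun u => (1 / 2) * (u ⬝ᵥ (M2 *ᵥ u)) + c2 ⬝ᵥ u
    let bJ1 : (Fin d1 ⊕ Fin d2 → ℝ) → ℝ := fun u => Real.cos θ1 * J1 u + Real.sin θ1 * J2 u
    let bJ2 : (Fin d1 ⊕ Fin d2 → ℝ) → ℝ := fun u => Real.cos θ2 * J2 u + Real.sin θ2 * J1 u
    let Mθ : Matrix (Fin d1 ⊕ Fin d2) (Fin d1 ⊕ Fin d2) ℝ :=
      Matrix.fromBlocks (Real.cos θ1 • A1 + Real.sin θ1 • D2)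
        (Real.cos θ2 • B2 + Real.sin θ2 • B1ᵀ)
        (Real.cos θ1 • B1 + Real.sin θ1 • B2ᵀ)
        (Real.cos θ2 • A2 + Real.sin θ2 • D1)
    let aθ : Fin d1 ⊕ Fin d2 → ℝ :=
      Sum.elim (Real.cos θ1 • a1 + Real.sin θ1 • b2) (Real.cos θ2 • a2 + Real.sin θ2 • b1)
    let uθ : Fin d1 ⊕ Fin d2 → ℝ := -((Mθ⁻¹)ᵀ *ᵥ aθ)
    IsUnit Mθ →
      HasFDerivAt (fun v : Fin d1 → ℝ => bJ1 (Sum.elim v (fun i => uθ (Sum.inr i))))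
          (0 : (Fin d1 → ℝ) →L[ℝ] ℝ) (fun i => uθ (Sum.inl i)) ∧
        HasFDerivAt (fun w : Fin d2 → ℝ => bJ2 (Sum.elim (fun i => uθ (Sum.inl i)) w))
          (0 : (Fin d2 → ℝ) →L[ℝ] ℝ) (fun i => uθ (Sum.inr i)) := by
  intro M1 M2 c1 c2 J1 J2 bJ1 bJ2 Mθ aθ uθ hM
  have hdet : IsUnit Mθᵀ.det := by
    rw [det_transpose]
    exact (isUnit_iff_isUnit_det Mθ).mp hM
  have hsys : Mθᵀ *ᵥ uθ + aθ = 0 := by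
    simp only [uθ]
    rw [mulVec_neg, transpose_nonsing_inv, mulVec_mulVec, mul_nonsing_inv _ hdet, one_mulVec,
      neg_add_cancel]
  set x : Fin d1 → ℝ := fun i => uθ (Sum.inl i)
  set y : Fin d2 → ℝ := fun i => uθ (Sum.inr i)
  have hu : uθ = Sum.elim x y := (Sum.elim_comp_inl_inr uθ).symm
  rw [hu] at hsys
  simp only [Mθ, aθ, fromBlocks_transpose, fromBlocks_mulVec, Sum.elim_comp_inl,
    Sum.elim_comp_inr, transpose_add, transpose_smul, transpose_transpose, hA1.eq, hA2.eq,
    hD1.eq, hD2.eq] at hsys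
  have hx : (Real.cos θ1 • A1 + Real.sin θ1 • D2) *ᵥ x +
      ((Real.cos θ1 • B1ᵀ + Real.sin θ1 • B2) *ᵥ y + (Real.cos θ1 • a1 + Real.sin θ1 • b2)) =
        0 := by
    rw [← add_assoc]
    exact funext fun i => congrFun hsys (Sum.inl i)
  have hy : (Real.cos θ2 • A2 + Real.sin θ2 • D1) *ᵥ y +
      ((Real.cos θ2 • B2ᵀ + Real.sin θ2 • B1) *ᵥ x + (Real.cos θ2 • a2 + Real.sin θ2 • b1)) =
        0 := by
    rw [← add_assoc, add_comm (_ *ᵥ y)]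
    exact funext fun i => congrFun hsys (Sum.inr i)
  have hJ1 (v : Fin d1 → ℝ) (w : Fin d2 → ℝ) : J1 (Sum.elim v w) = _ :=
    quadratic_fromBlocks A1 B1ᵀ D1 a1 v b1 w
  have hJ2 (v : Fin d1 → ℝ) (w : Fin d2 → ℝ) : J2 (Sum.elim v w) = _ :=
    quadratic_fromBlocks D2 B2 A2 b2 v a2 w
  have hT {m n : ℕ} (B : Matrix (Fin m) (Fin n) ℝ) (v : Fin m → ℝ) (w : Fin n → ℝ) :
      v ⬝ᵥ (B *ᵥ w) = (Bᵀ *ᵥ v) ⬝ᵥ w := by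
    rw [mulVec_transpose, dotProduct_mulVec]
  constructor
  · convert hasFDerivAt_quadratic_of_stationary ((hA1.smul _).add (hD2.smul _)) _
      (Real.cos θ1 * ((1 / 2) * (y ⬝ᵥ (D1 *ᵥ y)) + b1 ⬝ᵥ y) +
        Real.sin θ1 * ((1 / 2) * (y ⬝ᵥ (A2 *ᵥ y)) + a2 ⬝ᵥ y)) hx using 2 with v
    simp only [bJ1, hJ1, hJ2, add_mulVec, smul_mulVec, add_dotProduct, smul_dotProduct,
      dotProduct_add, dotProduct_smul, smul_eq_mul, dotProduct_comm (_ *ᵥ y) v]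
    ring
  · convert hasFDerivAt_quadratic_of_stationary ((hA2.smul _).add (hD1.smul _)) _
      (Real.cos θ2 * ((1 / 2) * (x ⬝ᵥ (D2 *ᵥ x)) + b2 ⬝ᵥ x) +
        Real.sin θ2 * ((1 / 2) * (x ⬝ᵥ (A1 *ᵥ x)) + a1 ⬝ᵥ x)) hy using 2 with w
    simp only [bJ2, hJ1, hJ2, add_mulVec, smul_mulVec, add_dotProduct, smul_dotProduct,
      dotProduct_add, dotProduct_smul, smul_eq_mul, hT _ x w, transpose_transpose]
    ring
end
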